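/- arXiv:1103.3710 — 2 statements merged into one kernel-verified Lean document; each statement's English description precedes it below -/
import Mathlib

section
/- In ℝ², the complement of any closed subset homeomorphic to ℝ (a closed embedded copy of the real line) is disconnected. -/
open Set Topology

/-- The part of `ℝ² × ℝ` above or off `L`. -/
def upperPart (L : Set (ℝ × ℝ)) : Set ((ℝ × ℝ) × ℝ) := {p | 0 < p.2 ∨ p.1 ∉ L}

lemma upperPart_isOpen {L : Set (ℝ × ℝ)} (hL : IsClosed L) : IsOpen (upperPart L) := by
  have h1 : IsOpen {p : (ℝ × ℝ) × ℝ | 0 < p.2} := isOpen_lt continuous_const continuous_snd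
  have h2 : IsOpen {p : (ℝ × ℝ) × ℝ | p.1 ∉ L} := hL.isOpen_compl.preimage continuous_fst
  exact h1.union h2

lemma upperPart_contractible (L : Set (ℝ × ℝ)) : ContractibleSpace (upperPart L) := by
  rw [contractible_iff_id_nullhomotopic]
  let r : C(upperPart L, upperPart L) :=
    ⟨fun p => ⟨(p.1.1, p.1.2 + |p.1.2| + 1), Or.inl (by
      have := neg_abs_le p.1.2
      show 0 < p.1.2 + |p.1.2| + 1
      linarith)⟩, by fun_prop⟩
  refine ⟨⟨(0, 1), Or.inl one_pos⟩, ?_⟩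
  have h1 : (ContinuousMap.id (upperPart L)).Homotopic r := by
    have hm : ∀ q : unitInterval × upperPart L,
        ((q.2.1.1, q.2.1.2 + (q.1 : ℝ) * (|q.2.1.2| + 1)) : (ℝ × ℝ) × ℝ) ∈ upperPart L := by
      intro q
      rcases q.2.2 with h | h
      · left
        show 0 < q.2.1.2 + (q.1 : ℝ) * (|q.2.1.2| + 1)
        have := q.1.2.1
        positivity
      · exact Or.inr h
    refine ⟨⟨⟨fun q => ⟨_, hm q⟩, Continuous.subtype_mk (by fun_prop) hm⟩, ?_, ?_⟩⟩
    · intro x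
      ext <;> simp
    · intro x
      ext <;> simp [r, add_assoc]
  refine h1.trans ?_
  have hm : ∀ q : unitInterval × upperPart L, (((1 - (q.1 : ℝ)) • q.2.1.1,
      (1 - (q.1 : ℝ)) * (q.2.1.2 + |q.2.1.2|) + 1) : (ℝ × ℝ) × ℝ) ∈ upperPart L := by
    intro q
    left
    show 0 < (1 - (q.1 : ℝ)) * (q.2.1.2 + |q.2.1.2|) + 1
    have h0 := q.1.2.2
    have h2 := neg_abs_le q.2.1.2
    have : 0 ≤ (1 - (q.1 : ℝ)) * (q.2.1.2 + |q.2.1.2|) :=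
      mul_nonneg (by linarith) (by linarith)
    linarith
  refine ⟨⟨⟨fun q => ⟨_, hm q⟩, Continuous.subtype_mk (by fun_prop) hm⟩, ?_, ?_⟩⟩
  · intro x
    ext <;> simp [r]
  · intro x
    ext <;> simp

lemma exists_log_upperPart {L : Set (ℝ × ℝ)} (hL : IsClosed L) {g : (ℝ × ℝ) × ℝ → ℂ}
    (hg : Continuous g) (h0 : ∀ p ∈ upperPart L, g p ≠ 0) :
    ∃ l : (ℝ × ℝ) × ℝ → ℂ, ContinuousOn l (upperPart L) ∧
      ∀ p ∈ upperPart L, Complex.exp (l p) = g p := by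
  have := upperPart_contractible L
  have hs : IsSimplyConnected (upperPart L) :=
    SimplyConnectedSpace.ofContractible _
  obtain ⟨l, hl, he⟩ := Complex.exists_continuousOn_eqOn_exp_comp hs (upperPart_isOpen hL)
    hg.continuousOn (by rintro ⟨p, hp, h⟩; exact h0 p hp h)
  exact ⟨l, hl, fun p hp => he hp⟩

lemma const_of_exp_eq_one {X : Type*} [TopologicalSpace X] {S : Set X} (hS : IsPreconnected S)
    {d : X → ℂ} (hd : ContinuousOn d S) (h1 : ∀ p ∈ S, Complex.exp (d p) = 1) :
    ∃ c : ℂ, Complex.exp c = 1 ∧ ∀ p ∈ S, d p = c := by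
  have hdisc : IsDiscrete (Complex.exp ⁻¹' {1}) :=
    ⟨(Complex.isCoveringMapOn_exp 1 (by simp)).discreteTopology_fiber⟩
  obtain ⟨c, hc, h⟩ := hS.eqOn_const_of_mapsTo hdisc hd (fun p hp => h1 p hp) ⟨0, by simp⟩
  exact ⟨c, hc, fun p hp => h hp⟩

/-- The complement of a closed embedded copy of ℝ in ℝ² is disconnected. -/
theorem complement_of_closed_line_disconnected (L : Set (ℝ × ℝ))
    (hL : IsClosed L) (φ : ℝ ≃ₜ L) :
    ¬ IsConnected Lᶜ := by
  intro hconn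
  classical
  -- Tietze extension of the inverse parametrization
  obtain ⟨f, hf⟩ := ContinuousMap.exists_extension' hL.isClosedEmbedding_subtypeVal
    (⟨φ.symm, φ.symm.continuous⟩ : C(L, ℝ))
  have hf' : ∀ x : L, f x = φ.symm x := fun x => congrFun hf x
  -- Klee's trick
  let v : (ℝ × ℝ) × ℝ → ℝ × ℝ := fun p => p.1 - (φ (p.2 + f p.1) : ℝ × ℝ)
  have hv : Continuous v := by fun_prop
  have hv0 : ∀ p, v p = 0 → p.1 ∈ L ∧ p.2 = 0 := by
    intro p hp
    have h1 : p.1 = (φ (p.2 + f p.1) : ℝ × ℝ) := sub_eq_zero.mp hp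
    have h2 : p.1 ∈ L := h1 ▸ (φ (p.2 + f p.1)).2
    refine ⟨h2, ?_⟩
    have h3 : (⟨p.1, h2⟩ : L) = φ (p.2 + f p.1) := Subtype.ext h1
    have h4 : f p.1 = p.2 + f p.1 := by
      have := hf' ⟨p.1, h2⟩
      rw [h3, φ.symm_apply_apply, ← h1] at this
      exact this
    linarith
  let g : (ℝ × ℝ) × ℝ → ℂ := fun p => Complex.equivRealProdCLM.symm (v p)
  have hg : Continuous g := Complex.equivRealProdCLM.symm.continuous.comp hv
  have hg0 : ∀ p, g p = 0 → p.1 ∈ L ∧ p.2 = 0 := fun p hp =>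
    hv0 p (by simpa [g] using hp)
  let m : (ℝ × ℝ) × ℝ → (ℝ × ℝ) × ℝ := fun p => (p.1, -p.2)
  have hm : Continuous m := by fun_prop
  obtain ⟨l₁, hl₁, he₁⟩ := exists_log_upperPart hL hg (by
    intro p hp h
    obtain ⟨h1, h2⟩ := hg0 p h
    rcases hp with hp | hp
    · exact hp.ne' h2
    · exact hp h1)
  obtain ⟨l₀, hl₀, he₀⟩ := exists_log_upperPart hL (hg.comp hm) (by
    intro p hp h
    obtain ⟨h1, h2⟩ := hg0 _ h
    rcases hp with hp | hp
    · exact hp.ne' (neg_eq_zero.mp h2)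
    · exact hp h1)
  let U := upperPart L
  let V := m ⁻¹' upperPart L
  have hU : IsOpen U := upperPart_isOpen hL
  have hV : IsOpen V := (upperPart_isOpen hL).preimage hm
  have hl₂ : ContinuousOn (l₀ ∘ m) V := hl₀.comp hm.continuousOn (fun p hp => hp)
  have he₂ : ∀ p ∈ V, Complex.exp ((l₀ ∘ m) p) = g p := by
    intro p hp
    have := he₀ (m p) hp
    simpa [m] using this
  have hUV : U ∩ V = Lᶜ ×ˢ univ := by
    ext ⟨x, t⟩
    simp only [U, V, m, upperPart, mem_inter_iff, mem_ofPred_eq, mem_preimage, mem_prod,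
      mem_compl_iff, mem_univ, and_true]
    constructor
    · rintro ⟨h1 | h1, h2 | h2⟩
      · linarith
      all_goals assumption
    · exact fun h => ⟨Or.inr h, Or.inr h⟩
  have hpre : IsPreconnected (U ∩ V) := by
    rw [hUV]
    exact hconn.isPreconnected.prod isPreconnected_univ
  obtain ⟨c, hc, hcc⟩ := const_of_exp_eq_one hpre (d := fun p => l₁ p - (l₀ ∘ m) p)
    ((hl₁.mono inter_subset_left).sub (hl₂.mono inter_subset_right)) (by
      rintro p ⟨hp1, hp2⟩
      have hne : g p ≠ 0 := by rw [← he₁ p hp1]; exact Complex.exp_ne_zero _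
      rw [Complex.exp_sub, he₁ p hp1, he₂ p hp2, div_self hne])
  -- the glued logarithm
  let l : (ℝ × ℝ) × ℝ → ℂ := fun p => if p ∈ U then l₁ p else (l₀ ∘ m) p + c
  have hlU : ∀ p ∈ U, l p = l₁ p := fun p hp => if_pos hp
  have hlV : ∀ p ∈ V, l p = (l₀ ∘ m) p + c := by
    intro p hp
    by_cases hpU : p ∈ U
    · rw [hlU p hpU, ← hcc p ⟨hpU, hp⟩]; ring
    · exact if_neg hpU
  have hlcU : ContinuousOn l U := hl₁.congr hlU
  have hlcV : ContinuousOn l V := (hl₂.add continuousOn_const).congr hlV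
  have hle : ∀ p, p ∈ U ∪ V → Complex.exp (l p) = g p := by
    rintro p (hp | hp)
    · rw [hlU p hp, he₁ p hp]
    · rw [hlV p hp, Complex.exp_add, hc, he₂ p hp, mul_one]
  -- the loop
  let x : ℝ → ℝ × ℝ := fun θ => (Real.cos θ, Real.sin θ) + (φ 0 : ℝ × ℝ)
  have hx : Continuous x := by fun_prop
  let γ : ℝ → (ℝ × ℝ) × ℝ := fun θ => (x θ, - f (x θ))
  have hγ : Continuous γ := by fun_prop
  have hgγ : ∀ θ : ℝ, g (γ θ) = Complex.exp (θ * Complex.I) := by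
    intro θ
    have : v (γ θ) = (Real.cos θ, Real.sin θ) := by simp [v, γ, x]
    simp only [g, this]
    rw [Complex.exp_mul_I]
    apply Complex.ext <;> simp [Complex.cos_ofReal_re, Complex.sin_ofReal_re]
  have hγUV : ∀ θ, γ θ ∈ U ∪ V := by
    intro θ
    by_contra hcon
    simp only [U, V, m, upperPart, mem_union, mem_ofPred_eq, mem_preimage, not_or, not_not,
      not_lt] at hcon
    obtain ⟨⟨h1, h2⟩, h3, -⟩ := hcon
    have ht : (γ θ).2 = 0 := by linarith
    have : g (γ θ) = 0 := by
      have h5 : f (γ θ).1 = φ.symm ⟨(γ θ).1, h2⟩ := hf' ⟨_, h2⟩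
      simp [g, v, ht, h5]
    rw [hgγ] at this
    exact Complex.exp_ne_zero _ this
  have hlγ : Continuous (fun θ => l (γ θ)) := by
    rw [continuous_iff_continuousAt]
    intro θ
    have : ContinuousAt l (γ θ) := by
      rcases hγUV θ with h | h
      · exact hlcU.continuousAt (hU.mem_nhds h)
      · exact hlcV.continuousAt (hV.mem_nhds h)
    exact ContinuousAt.comp (f := γ) this hγ.continuousAt
  obtain ⟨k, -, hk⟩ := const_of_exp_eq_one (X := ℝ) isPreconnected_univ
    (d := fun θ => l (γ θ) - θ * Complex.I)
    (hlγ.sub (Complex.continuous_ofReal.mul continuous_const)).continuousOn (by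
      intro θ _
      rw [Complex.exp_sub, hle _ (hγUV θ), hgγ, div_self (Complex.exp_ne_zero _)])
  have e0 := hk 0 trivial
  have e1 := hk (2 * Real.pi) trivial
  have hper : γ (2 * Real.pi) = γ 0 := by simp [γ, x]
  simp only [hper] at e1
  rw [← e1] at e0
  have : ((2 * Real.pi : ℝ) : ℂ) * Complex.I = 0 := by
    have := e0
    simp only [Complex.ofReal_zero, zero_mul, sub_zero] at this
    exact (sub_eq_self.mp this.symm)
  simp [Real.pi_ne_zero] at this
end

section
/- If a closed subset L of ℝ² is homeomorphic to ℝ and L ∪ {∞} is homeomorphic to the circle S¹ inside the one-point compactification S² of ℝ², then ℝ² \ L has exactly two connected components, each homeomorphic to ℝ². -/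
noncomputable section

open Set Filter Topology MeasureTheory

/-- Twice the Wirtinger derivative with respect to the conjugate variable. -/
def dbar (f : ℂ → ℂ) (w : ℂ) : ℂ := fderiv ℝ f w 1 + Complex.I * fderiv ℝ f w Complex.I

lemma dbar_eq_zero {f : ℂ → ℂ} {w : ℂ} (h : DifferentiableAt ℂ f w) : dbar f w = 0 := by
  have h1 : HasFDerivAt f ((fderiv ℂ f w).restrictScalars ℝ) w :=
    h.hasFDerivAt.restrictScalars ℝ
  have h2 := h1.fderiv
  have h3 : fderiv ℂ f w Complex.I = Complex.I * fderiv ℂ f w 1 := by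
    have := (fderiv ℂ f w).map_smul Complex.I 1
    simpa using this
  rw [dbar, h2]
  simp only [ContinuousLinearMap.coe_restrictScalars']
  rw [h3, ← mul_assoc, Complex.I_mul_I]; ring

lemma dbar_congr {f g : ℂ → ℂ} {w : ℂ} (h : f =ᶠ[𝓝 w] g) : dbar f w = dbar g w := by
  rw [dbar, dbar, h.fderiv_eq]

lemma dbar_mul {f g : ℂ → ℂ} {w : ℂ} (hf : DifferentiableAt ℝ f w) (hg : DifferentiableAt ℝ g w) :
    dbar (fun x => f x * g x) w = f w * dbar g w + dbar f w * g w := by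
  have := (hf.hasFDerivAt.mul hg.hasFDerivAt).fderiv
  simp only [dbar]
  erw [this]
  simp
  ring

lemma dbar_sub {f g : ℂ → ℂ} {w : ℂ} (hf : DifferentiableAt ℝ f w) (hg : DifferentiableAt ℝ g w) :
    dbar (fun x => f x - g x) w = dbar f w - dbar g w := by
  have := (hf.hasFDerivAt.sub hg.hasFDerivAt).fderiv
  simp only [dbar]
  erw [this]
  simp
  ring

lemma dbar_const_mul {f : ℂ → ℂ} {w : ℂ} (c : ℂ) (hf : DifferentiableAt ℝ f w) :
    dbar (fun x => c * f x) w = c * dbar f w := by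
  rw [dbar_mul (differentiableAt_const c) hf, dbar_eq_zero (differentiableAt_const c)]; ring

lemma continuous_dbar {f : ℂ → ℂ} (hf : ContDiff ℝ 1 f) : Continuous (dbar f) := by
  have h := hf.continuous_fderiv one_ne_zero
  unfold dbar
  fun_prop

lemma hasCompactSupport_dbar {f : ℂ → ℂ} (hf : HasCompactSupport f) :
    HasCompactSupport (dbar f) := by
  refine HasCompactSupport.intro hf.isCompact fun x hx => ?_
  rw [dbar_congr (g := fun _ => 0) (notMem_tsupport_iff_eventuallyEq.1 hx)]
  exact dbar_eq_zero (differentiableAt_const _)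

lemma integral_fderiv_apply_zero {f : ℂ → ℂ} (hf : ContDiff ℝ 1 f) (hc : HasCompactSupport f)
    (v : ℂ) : ∫ w, fderiv ℝ f w v = 0 := by
  have h := hf.continuous_fderiv one_ne_zero
  have hi : Integrable (fun w => fderiv ℝ f w v) := by
    refine Continuous.integrable_of_hasCompactSupport (by fun_prop) ?_
    refine HasCompactSupport.intro hc.isCompact fun x hx => ?_
    rw [Filter.EventuallyEq.fderiv_eq (f := fun _ => 0) (notMem_tsupport_iff_eventuallyEq.1 hx)]
    simp
  have := integral_mul_fderiv_eq_neg_fderiv_mul_of_integrable (μ := (volume : Measure ℂ))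
    (f := fun _ : ℂ => (1 : ℂ)) (g := f) (v := v) (by simp) (by simpa using hi)
    (by simpa using hf.continuous.integrable_of_hasCompactSupport hc) (by simp)
    (fun x _ => hf.differentiable one_ne_zero x)
  simpa using this

lemma integral_dbar {f : ℂ → ℂ} (hf : ContDiff ℝ 1 f) (hc : HasCompactSupport f) :
    ∫ w, dbar f w = 0 := by
  have h := hf.continuous_fderiv one_ne_zero
  have hi (v : ℂ) : Integrable (fun w => fderiv ℝ f w v) := by
    refine Continuous.integrable_of_hasCompactSupport (by fun_prop) ?_
    refine HasCompactSupport.intro hc.isCompact fun x hx => ?_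
    rw [Filter.EventuallyEq.fderiv_eq (f := fun _ => 0) (notMem_tsupport_iff_eventuallyEq.1 hx)]
    simp
  unfold dbar
  rw [integral_add (hi 1) ((hi _).const_mul _), integral_const_mul,
    integral_fderiv_apply_zero hf hc, integral_fderiv_apply_zero hf hc]
  simp

lemma integral_dbar_div {f : ℂ → ℂ} {z : ℂ} (hf : ContDiff ℝ 1 f) (hc : HasCompactSupport f)
    (hz : f z = 0) (hd : ∀ᶠ w in 𝓝 z, DifferentiableAt ℂ f w) :
    ∫ w, dbar f w * (w - z)⁻¹ = 0 := by
  set ψ := dslope f z with hψ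
  have hdz : ∀ᶠ w in 𝓝 z, DifferentiableAt ℂ ψ w := by
    obtain ⟨s, hs, hso, hzs⟩ := eventually_nhds_iff.1 hd
    have : DifferentiableOn ℂ ψ s :=
      (Complex.differentiableOn_dslope (hso.mem_nhds hzs)).2
        fun w hw => (hs w hw).differentiableWithinAt
    filter_upwards [hso.mem_nhds hzs] with w hw
    exact this.differentiableAt (hso.mem_nhds hw)
  have heq : ∀ w, w ≠ z → ψ =ᶠ[𝓝 w] fun x => f x * (x - z)⁻¹ := by
    intro w hw
    filter_upwards [isOpen_ne.mem_nhds hw] with x hx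
    rw [hψ, dslope_of_ne _ hx, slope_def_field, hz]; simp [div_eq_mul_inv]
  have hinv : ∀ w, w ≠ z → ContDiffAt ℂ 1 (fun x => (x - z)⁻¹) w := by
    intro w hw
    exact (contDiffAt_id.sub contDiffAt_const).inv (sub_ne_zero.2 hw)
  have h1 : ContDiff ℝ 1 ψ := by
    rw [contDiff_iff_contDiffAt]
    intro w
    by_cases hw : w = z
    · subst hw
      have : AnalyticAt ℂ ψ w := by
        obtain ⟨s, hs, hso, hzs⟩ := eventually_nhds_iff.1 hdz
        exact DifferentiableOn.analyticAt (s := s)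
          (fun x hx => (hs x hx).differentiableWithinAt) (hso.mem_nhds hzs)
      exact (this.contDiffAt (n := 1)).restrict_scalars ℝ
    · exact (hf.contDiffAt.mul ((hinv w hw).restrict_scalars ℝ)).congr_of_eventuallyEq (heq w hw)
  have h2 : HasCompactSupport ψ := by
    refine HasCompactSupport.intro (hc.isCompact.union (isCompact_singleton (x := z))) ?_
    intro x hx
    simp only [mem_union, mem_singleton_iff, not_or] at hx
    rw [(heq x hx.2).self_of_nhds]
    simp [image_eq_zero_of_notMem_tsupport hx.1]
  rw [← integral_dbar h1 h2]
  congr 1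
  ext w
  by_cases hw : w = z
  · subst hw
    rw [dbar_eq_zero hdz.self_of_nhds]; simp
  · rw [dbar_congr (heq w hw), dbar_mul (hf.differentiable one_ne_zero w)
      (((hinv w hw).restrict_scalars ℝ).differentiableAt one_ne_zero),
      dbar_eq_zero ((hinv w hw).differentiableAt one_ne_zero)]
    ring

/-- radial cutoff -/
def radCut (z w : ℂ) : ℂ := (Real.smoothTransition (2 - ‖w - z‖ ^ 2) : ℝ)

lemma contDiff_radCut (z : ℂ) : ContDiff ℝ 1 (radCut z) := by
  have h : ContDiff ℝ 1 (fun w : ℂ => Real.smoothTransition (2 - ‖w - z‖ ^ 2)) := by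
    refine (Real.smoothTransition.contDiff (n := 1)).comp ?_
    exact contDiff_const.sub ((contDiff_id.sub contDiff_const).norm_sq ℝ)
  exact Complex.ofRealCLM.contDiff.comp h

lemma hasCompactSupport_radCut (z : ℂ) : HasCompactSupport (radCut z) := by
  refine HasCompactSupport.intro (isCompact_closedBall z 2) fun x hx => ?_
  rw [Metric.mem_closedBall, dist_eq_norm, not_le] at hx
  simp only [radCut, Complex.ofReal_eq_zero]
  exact Real.smoothTransition.zero_of_nonpos (by nlinarith)

lemma radCut_eventually (z : ℂ) : radCut z =ᶠ[𝓝 z] fun _ => 1 := by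
  filter_upwards [Metric.ball_mem_nhds z one_pos] with w hw
  rw [Metric.mem_ball, dist_eq_norm] at hw
  simp only [radCut, Complex.ofReal_eq_one]
  exact Real.smoothTransition.one_of_one_le (by nlinarith [norm_nonneg (w - z)])

lemma dbar_radCut (z w : ℂ) :
    dbar (radCut z) w = -2 * (deriv Real.smoothTransition (2 - ‖w - z‖ ^ 2) : ℝ) * (w - z) := by
  have h1 : HasFDerivAt (fun w : ℂ => 2 - ‖w - z‖ ^ 2) (-(2 • innerSL ℝ (w - z))) w := by
    have := ((hasFDerivAt_id (𝕜 := ℝ) w).sub_const z).norm_sq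
    simpa using! this.const_sub 2
  have h2 : HasDerivAt Real.smoothTransition (deriv Real.smoothTransition (2 - ‖w - z‖ ^ 2))
      (2 - ‖w - z‖ ^ 2) :=
    ((Real.smoothTransition.contDiff (n := 1)).differentiable one_ne_zero _).hasDerivAt
  have h3 := Complex.ofRealCLM.hasFDerivAt.comp w (h2.comp_hasFDerivAt w h1)
  have h4 : fderiv ℝ (radCut z) w = _ := h3.fderiv
  rw [dbar, h4]
  apply Complex.ext <;> simp [Complex.inner] <;> ring

/-- the normalising constant -/
def cRad : ℝ := 2 * ∫ w : ℂ, deriv Real.smoothTransition (2 - ‖w‖ ^ 2)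

lemma deriv_st_continuous : Continuous (deriv Real.smoothTransition) :=
  (Real.smoothTransition.contDiff (n := 1)).continuous_deriv le_rfl

lemma cRad_pos : 0 < cRad := by
  have hd : Differentiable ℝ Real.smoothTransition :=
    (Real.smoothTransition.contDiff (n := 1)).differentiable one_ne_zero
  obtain ⟨s, hs, hs'⟩ := exists_deriv_eq_slope Real.smoothTransition (zero_lt_one' ℝ)
    hd.continuous.continuousOn hd.differentiableOn
  have hs1 : deriv Real.smoothTransition s = 1 := by
    rw [hs']; simp
  have : 0 < ∫ w : ℂ, deriv Real.smoothTransition (2 - ‖w‖ ^ 2) := by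
    refine Continuous.integral_pos_of_hasCompactSupport_nonneg_nonzero
      (x := ((Real.sqrt (2 - s) : ℝ) : ℂ)) ?_ ?_ ?_ ?_
    · have := deriv_st_continuous
      fun_prop
    · refine HasCompactSupport.intro (isCompact_closedBall (0 : ℂ) 2) fun x hx => ?_
      rw [Metric.mem_closedBall, dist_zero_right, not_le] at hx
      have : Real.smoothTransition =ᶠ[𝓝 (2 - ‖x‖ ^ 2)] fun _ => 0 := by
        filter_upwards [Iio_mem_nhds (show 2 - ‖x‖ ^ 2 < 0 by nlinarith)] with y hy
        exact Real.smoothTransition.zero_of_nonpos hy.le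
      rw [this.deriv_eq]; simp
    · intro w
      exact Real.smoothTransition.monotone.deriv_nonneg
    · have : (2 : ℝ) - ‖((Real.sqrt (2 - s) : ℝ) : ℂ)‖ ^ 2 = s := by
        rw [Complex.norm_real, Real.norm_eq_abs, sq_abs, Real.sq_sqrt (by linarith [hs.2])]; ring
      rw [this, hs1]; exact one_ne_zero
  unfold cRad; positivity

lemma integral_radCut (z : ℂ) : ∫ w, dbar (radCut z) w * (w - z)⁻¹ = -(cRad : ℂ) := by
  have : ∀ᵐ w : ℂ, dbar (radCut z) w * (w - z)⁻¹ =
      -2 * ((deriv Real.smoothTransition (2 - ‖w - z‖ ^ 2) : ℝ) : ℂ) := by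
    have : ∀ᵐ w : ℂ, w ≠ z := by
      simp [ae_iff]
    filter_upwards [this] with w hw
    have := sub_ne_zero.2 hw
    rw [dbar_radCut]; field_simp
  rw [integral_congr_ae this, integral_const_mul,
    integral_sub_right_eq_self (fun w : ℂ => ((deriv Real.smoothTransition (2 - ‖w‖ ^ 2) : ℝ) : ℂ)) z,
    integral_complex_ofReal, cRad]
  push_cast; ring

lemma cauchy_repr {U K : Set ℂ} (hU : IsOpen U) (hK : IsCompact K) (hKU : K ⊆ U) {g : ℂ → ℂ}
    (hg : DifferentiableOn ℂ g U) : ∃ h : ℂ → ℂ, Continuous h ∧ HasCompactSupport h ∧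
      (∀ᶠ w in 𝓝ˢ K, h w = 0) ∧ ∀ z ∈ K, g z = ∫ w, h w * (w - z)⁻¹ := by
  obtain ⟨t, ht, hKt, htU⟩ := exists_compact_between hK hU hKU
  obtain ⟨χ, hχ1, hχ0, -⟩ := exists_contMDiffMap_one_nhds_of_subset_interior
    (n := 1) (modelWithCornersSelf ℝ ℂ) hK.isClosed hKt
  have hχs : ContDiff ℝ 1 (fun w => ((χ w : ℝ) : ℂ)) :=
    Complex.ofRealCLM.contDiff.comp (χ.contMDiff.contDiff)
  have hgs : ∀ w ∈ U, ContDiffAt ℂ 1 g w := fun w hw =>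
    (hg.analyticAt (hU.mem_nhds hw)).contDiffAt
  set φ : ℂ → ℂ := fun w => (χ w : ℝ) * g w with hφ
  have hφs : ContDiff ℝ 1 φ := by
    rw [contDiff_iff_contDiffAt]
    intro w
    by_cases hw : w ∈ U
    · exact hχs.contDiffAt.mul ((hgs w hw).restrict_scalars ℝ)
    · have hw' : w ∈ tᶜ := fun h => hw (htU h)
      have : φ =ᶠ[𝓝 w] fun _ => 0 := by
        filter_upwards [ht.isClosed.isOpen_compl.mem_nhds hw'] with x hx
        simp [hφ, hχ0 x hx]
      exact contDiffAt_const.congr_of_eventuallyEq this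
  have hφc : HasCompactSupport φ := HasCompactSupport.intro ht fun x hx => by
    simp [hφ, hχ0 x hx]
  have hnear : ∀ᶠ w in 𝓝ˢ K, φ =ᶠ[𝓝 w] g ∧ w ∈ U := by
    have h1 : ∀ᶠ w in 𝓝ˢ K, φ w = g w := by
      filter_upwards [hχ1] with w hw
      simp [hφ, hw]
    rw [eventually_nhdsSet_iff_forall] at h1 ⊢
    intro x hx
    filter_upwards [eventually_eventually_nhds.2 (h1 x hx),
      hU.mem_nhds (hKU hx)] with w h1 h2 using ⟨h1, h2⟩
  have hc := cRad_pos.ne'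
  refine ⟨fun w => -(cRad : ℂ)⁻¹ * dbar φ w, continuous_const.mul (continuous_dbar hφs),
    (hasCompactSupport_dbar hφc).mul_left, ?_, ?_⟩
  · filter_upwards [hnear] with w hw
    rw [dbar_congr hw.1, dbar_eq_zero (hg.differentiableAt (hU.mem_nhds hw.2)), mul_zero]
  · intro z hz
    have hzn : φ =ᶠ[𝓝 z] g := ((eventually_nhdsSet_iff_forall.1 hnear) z hz).self_of_nhds.1
    set F : ℂ → ℂ := fun w => φ w - g z * radCut z w with hF
    have hR := contDiff_radCut z
    have hF1 : ContDiff ℝ 1 F := hφs.sub (contDiff_const.mul hR)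
    have hF2 : HasCompactSupport F := hφc.sub ((hasCompactSupport_radCut z).mul_left)
    have hF3 : F z = 0 := by
      simp [hF, hzn.self_of_nhds, (radCut_eventually z).self_of_nhds]
    have hF4 : ∀ᶠ w in 𝓝 z, DifferentiableAt ℂ F w := by
      have : ∀ᶠ w in 𝓝 z, F w = g w - g z := by
        filter_upwards [hzn, radCut_eventually z] with w h1 h2
        simp [hF, h1, h2]
      filter_upwards [eventually_eventually_nhds.2 this, hU.mem_nhds (hKU hz)] with w h1 h2
      exact ((hg.differentiableAt (hU.mem_nhds h2)).sub_const (g z)).congr_of_eventuallyEq h1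
    have key := integral_dbar_div hF1 hF2 hF3 hF4
    have hintg : ∀ ψ : ℂ → ℂ, ContDiff ℝ 1 ψ → HasCompactSupport ψ →
        (∀ᶠ w in 𝓝 z, DifferentiableAt ℂ ψ w) → Integrable fun w => dbar ψ w * (w - z)⁻¹ := by
      intro ψ h1 h2 h3
      refine Continuous.integrable_of_hasCompactSupport ?_ (hasCompactSupport_dbar h2).mul_right
      rw [continuous_iff_continuousAt]
      intro w
      by_cases hw : w = z
      · subst hw
        have : (fun x => dbar ψ x * (x - w)⁻¹) =ᶠ[𝓝 w] fun _ => 0 := by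
          filter_upwards [h3] with x hx
          rw [dbar_eq_zero hx, zero_mul]
        exact continuousAt_const.congr this.symm
      · exact (continuous_dbar h1).continuousAt.mul
          ((continuousAt_id.sub continuousAt_const).inv₀ (sub_ne_zero.2 hw))
    have i1 : Integrable fun w => dbar φ w * (w - z)⁻¹ := hintg φ hφs hφc (by
      filter_upwards [eventually_eventually_nhds.2 hzn, hU.mem_nhds (hKU hz)] with w h1 h2
      exact (hg.differentiableAt (hU.mem_nhds h2)).congr_of_eventuallyEq h1)
    have i2 : Integrable fun w => dbar (radCut z) w * (w - z)⁻¹ :=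
      hintg _ hR (hasCompactSupport_radCut z) (by
        filter_upwards [eventually_eventually_nhds.2 (radCut_eventually z)] with w h1
        exact (differentiableAt_const (1 : ℂ)).congr_of_eventuallyEq h1)
    have e : (fun w => dbar F w * (w - z)⁻¹) =
        fun w => dbar φ w * (w - z)⁻¹ - g z * (dbar (radCut z) w * (w - z)⁻¹) := by
      ext w
      have d1 : DifferentiableAt ℝ (radCut z) w := hR.differentiable one_ne_zero w
      rw [hF, dbar_sub (hφs.differentiable one_ne_zero w) (d1.const_mul _),
        dbar_const_mul _ d1]
      ring
    rw [e, integral_sub i1 (i2.const_mul _), integral_const_mul, integral_radCut] at key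
    have hc' : (cRad : ℂ) ≠ 0 := by exact_mod_cast hc
    have key2 : ∫ w, dbar φ w * (w - z)⁻¹ = - (cRad : ℂ) * g z := by linear_combination key
    simp only [mul_assoc]
    rw [integral_const_mul, key2]
    field_simp

end


noncomputable section

open Set Filter Topology MeasureTheory

/-- The closure of polynomial functions in `C(K, ℂ)`. -/
abbrev polyClosure (K : Set ℂ) [CompactSpace K] : Subalgebra ℂ C(K, ℂ) :=
  (polynomialFunctions K).topologicalClosure

lemma polyClosure_isClosed (K : Set ℂ) [CompactSpace K] :
    IsClosed (polyClosure K : Set C(K, ℂ)) :=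
  Subalgebra.isClosed_topologicalClosure _

lemma polyClosure_inv {K : Set ℂ} [CompactSpace K] {a : C(K, ℂ)} (ha : a ∈ polyClosure K)
    (h : ‖a‖ < 1) : ∃ b ∈ polyClosure K, b * (1 - a) = 1 := by
  refine ⟨∑' i : ℕ, a ^ i, ?_, geom_series_mul_neg a h⟩
  have hs := (summable_geometric_of_norm_lt_one h).hasSum
  refine (polyClosure_isClosed K).mem_of_tendsto hs (Eventually.of_forall fun s => ?_)
  exact sum_mem fun i _ => pow_mem ha i

/-- resolvent function -/
def IsRes (K : Set ℂ) [CompactSpace K] (w : ℂ) : Prop :=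
  ∃ r ∈ polyClosure K, ∀ z : K, r z * ((z : ℂ) - w) = 1

lemma isRes_step {K : Set ℂ} [CompactSpace K] {w w' : ℂ} {δ : ℝ}
    (hδ : ∀ z : K, δ ≤ ‖(z : ℂ) - w‖) (hw : ‖w' - w‖ < δ) (h : IsRes K w) : IsRes K w' := by
  obtain ⟨r, hr, hr'⟩ := h
  have hδ0 : 0 < δ := (norm_nonneg _).trans_lt hw
  have hn : ‖(w' - w) • r‖ < 1 := by
    rw [ContinuousMap.norm_lt_iff _ one_pos]
    intro z
    have h1 := congrArg norm (hr' z)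
    rw [norm_mul, norm_one] at h1
    have h2 := hδ z
    simp only [ContinuousMap.coe_smul, Pi.smul_apply, smul_eq_mul, norm_mul]
    have h3 : 0 < ‖r z‖ := by
      rcases (norm_nonneg (r z)).eq_or_lt with h | h
      · rw [← h] at h1; simp at h1
      · exact h
    nlinarith
  obtain ⟨b, hb, hb'⟩ := polyClosure_inv ((polyClosure K).smul_mem hr (w' - w)) hn
  refine ⟨b * r, mul_mem hb hr, fun z => ?_⟩
  have h1 := congrArg (fun f : C(K, ℂ) => f z) hb'
  simp only [ContinuousMap.mul_apply, ContinuousMap.sub_apply, ContinuousMap.one_apply,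
    ContinuousMap.smul_apply, smul_eq_mul] at h1
  simp only [ContinuousMap.mul_apply]
  linear_combination h1 + b z * hr' z

lemma isRes_far {K : Set ℂ} [CompactSpace K] {w : ℂ} {R : ℝ} (hR : ∀ z : K, ‖(z : ℂ)‖ ≤ R)
    (hR0 : 0 ≤ R) (hw : R < ‖w‖) : IsRes K w := by
  have hw0 : w ≠ 0 := by
    rintro rfl; simp at hw; linarith
  set x : C(K, ℂ) := ⟨fun z => (z : ℂ), continuous_subtype_val⟩ with hx
  have hxm : x ∈ polyClosure K := by
    refine Subalgebra.le_topologicalClosure _ ?_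
    rw [← SetLike.mem_coe, polynomialFunctions_coe]
    exact ⟨Polynomial.X, by ext z; simp [hx]⟩
  have hn : ‖w⁻¹ • x‖ < 1 := by
    rw [ContinuousMap.norm_lt_iff _ one_pos]
    intro z
    simp only [ContinuousMap.coe_smul, Pi.smul_apply, smul_eq_mul, norm_mul, norm_inv]
    have : 0 < ‖w‖ := by positivity
    rw [inv_mul_lt_one₀ this]
    exact (hR z).trans_lt hw
  obtain ⟨b, hb, hb'⟩ := polyClosure_inv ((polyClosure K).smul_mem hxm w⁻¹) hn
  refine ⟨(-w⁻¹) • b, (polyClosure K).smul_mem hb _, fun z => ?_⟩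
  have h1 := congrArg (fun f : C(K, ℂ) => f z) hb'
  simp only [ContinuousMap.mul_apply, ContinuousMap.sub_apply, ContinuousMap.one_apply,
    ContinuousMap.smul_apply, smul_eq_mul] at h1
  simp only [ContinuousMap.smul_apply, smul_eq_mul]
  have h2 : x z = z := rfl
  rw [h2] at h1
  rw [← h1]
  field_simp
  ring

lemma isRes_all {K : Set ℂ} [CompactSpace K] (hK : IsCompact K) (hc : IsPreconnected Kᶜ)
    {w : ℂ} (hw : w ∉ K) : IsRes K w := by
  obtain ⟨R, hR⟩ := hK.isBounded.exists_norm_le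
  set R' := max R 0
  have hR' : ∀ z : K, ‖(z : ℂ)‖ ≤ R' := fun z => (hR z z.2).trans (le_max_left _ _)
  set w0 : ℂ := ((R' + 1 : ℝ) : ℂ) with hw0
  have hR0 : 0 ≤ R' := le_max_right _ _
  have hn : ‖w0‖ = R' + 1 := by
    rw [hw0, Complex.norm_real, Real.norm_of_nonneg (by linarith)]
  have h0 : IsRes K w0 := isRes_far hR' hR0 (by linarith)
  have h0K : w0 ∈ Kᶜ := fun h => by
    have := hR' ⟨w0, h⟩
    simp only [hn] at this; linarith
  refine (hc.induction₂ (fun x y => IsRes K x ↔ IsRes K y) ?_ (fun x y z _ _ _ => Iff.trans)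
    (fun x y _ _ => Iff.symm) h0K hw).1 h0
  intro x hx
  obtain ⟨δ, hδ, hb⟩ := Metric.isOpen_iff.1 hK.isClosed.isOpen_compl x hx
  refine mem_nhdsWithin_of_mem_nhds ?_
  filter_upwards [Metric.ball_mem_nhds x (half_pos hδ)] with y hy
  rw [Metric.mem_ball, dist_eq_norm] at hy
  have hd : ∀ z : K, δ ≤ ‖(z : ℂ) - x‖ := fun z => by
    by_contra h
    exact hb (by rw [Metric.mem_ball, dist_eq_norm]; exact not_le.1 h) z.2
  constructor
  · exact isRes_step hd (by linarith)
  · refine isRes_step (δ := δ / 2) (fun z => ?_) (by rwa [norm_sub_rev])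
    have := norm_sub_le_norm_sub_add_norm_sub (z : ℂ) y x
    linarith [hd z]

theorem runge {U K : Set ℂ} (hU : IsOpen U) (hK : IsCompact K) (hKU : K ⊆ U)
    (hc : IsPreconnected Kᶜ) {g : ℂ → ℂ} (hg : DifferentiableOn ℂ g U) {ε : ℝ} (hε : 0 < ε) :
    ∃ p : Polynomial ℂ, ∀ z ∈ K, ‖p.eval z - g z‖ < ε := by
  haveI : CompactSpace K := isCompact_iff_compactSpace.1 hK
  obtain ⟨h, hhc, hhs, hh0, hrep⟩ := cauchy_repr hU hK hKU hg
  let J : C(ℂ × K, ℂ) := ⟨fun p => h p.1 * (p.1 - (p.2 : ℂ))⁻¹, by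
    rw [continuous_iff_continuousAt]
    rintro ⟨w, z⟩
    by_cases hw : w = z
    · have h1 := (eventually_nhdsSet_iff_forall.1 hh0) z z.2
      rw [← hw] at h1
      have h2 : ∀ᶠ p : ℂ × K in 𝓝 (w, z), h p.1 * (p.1 - (p.2 : ℂ))⁻¹ = 0 := by
        filter_upwards [continuousAt_fst.eventually h1] with p hp
        rw [hp, zero_mul]
      exact continuousAt_const.congr (h2.mono fun p hp => hp.symm)
    · refine ContinuousAt.mul (by fun_prop) (ContinuousAt.inv₀ (by fun_prop) ?_)
      exact sub_ne_zero.2 hw⟩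
  have hJ : ∀ w, J.curry w ∈ polyClosure K := by
    intro w
    by_cases hw : w ∈ K
    · have h1 : h w = 0 := ((eventually_nhdsSet_iff_forall.1 hh0) w hw).self_of_nhds
      have : J.curry w = 0 := by
        ext z; simp [J, h1]
      rw [this]; exact zero_mem _
    · obtain ⟨r, hr, hr'⟩ := isRes_all hK hc hw
      have : J.curry w = (-h w) • r := by
        ext z
        simp only [ContinuousMap.curry_apply, J, ContinuousMap.coe_mk, ContinuousMap.smul_apply,
          smul_eq_mul]
        have hne : w - z ≠ 0 := sub_ne_zero.2 fun e => hw (e ▸ z.2)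
        field_simp
        linear_combination (-h w) * hr' z
      rw [this]; exact (polyClosure K).smul_mem hr _
  let A : Submodule ℂ C(K, ℂ) := Subalgebra.toSubmodule (polyClosure K)
  haveI : CompleteSpace A := (polyClosure_isClosed K).isComplete.completeSpace_coe
  let Jt : ℂ → A := fun w => ⟨J.curry w, hJ w⟩
  have hJc : Continuous Jt := J.curry.continuous.subtype_mk _
  have hJs : HasCompactSupport Jt := HasCompactSupport.intro hhs.isCompact fun x hx => by
    apply Subtype.ext
    ext z
    simp [Jt, J, image_eq_zero_of_notMem_tsupport hx]
  have hJi : Integrable Jt := hJc.integrable_of_hasCompactSupport hJs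
  set v : A := ∫ w, Jt w with hv
  have hvz : ∀ z : K, (v : C(K, ℂ)) z = g z := by
    intro z
    let L : A →L[ℂ] ℂ := (ContinuousMap.evalCLM ℂ z).comp A.subtypeL
    have h1 : ∫ w, L (Jt w) = L v := L.integral_comp_comm hJi
    rw [hrep z z.2]
    exact h1.symm
  have hvm : (v : C(K, ℂ)) ∈ closure (polynomialFunctions K : Set C(K, ℂ)) := v.2
  obtain ⟨q, hq, hqd⟩ := Metric.mem_closure_iff.1 hvm ε hε
  rw [polynomialFunctions_coe] at hq
  obtain ⟨p, rfl⟩ := hq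
  refine ⟨p, fun z hz => ?_⟩
  rw [dist_comm, dist_eq_norm, ContinuousMap.norm_lt_iff _ hε] at hqd
  have := hqd ⟨z, hz⟩
  rw [ContinuousMap.sub_apply, hvz] at this
  simpa using this

lemma isPreconnected_norm_gt {R : ℝ} (hR : 0 < R) : IsPreconnected {z : ℂ | R < ‖z‖} := by
  have : {z : ℂ | R < ‖z‖} = Complex.exp '' {z | Real.log R < z.re} := by
    ext z
    simp only [mem_setOf_eq, mem_image]
    constructor
    · intro h
      have hz : z ≠ 0 := by rintro rfl; simp at h; linarith
      exact ⟨Complex.log z, by rw [Complex.log_re]; exact Real.log_lt_log hR h, Complex.exp_log hz⟩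
    · rintro ⟨w, hw, rfl⟩
      rw [Complex.norm_exp]
      exact (Real.log_lt_iff_lt_exp hR).1 hw
  rw [this]
  exact (convex_halfSpace_re_gt _).isPreconnected.image _ Complex.continuous_exp.continuousOn

lemma isPreconnected_thickening {s : Set ℂ} (hs : IsPreconnected s) (δ : ℝ) :
    IsPreconnected (Metric.thickening δ s) := by
  rcases s.eq_empty_or_nonempty with rfl | ⟨x0, hx0⟩
  · simpa using isPreconnected_empty
  by_cases hδ : 0 < δ
  swap
  · rw [Metric.thickening_of_nonpos (not_lt.1 hδ)]; exact isPreconnected_empty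
  refine isPreconnected_of_forall x0 fun y hy => ?_
  obtain ⟨x, hx, hxy⟩ := Metric.mem_thickening_iff.1 hy
  refine ⟨s ∪ Metric.ball x δ, union_subset (Metric.self_subset_thickening hδ s)
    (Metric.ball_subset_thickening hx δ), Or.inl hx0, Or.inr hxy, ?_⟩
  exact hs.union x hx (Metric.mem_ball_self hδ) (convex_ball x δ).isPreconnected

theorem exists_primitive {U : Set ℂ} (hU : IsOpen U) (hUc : IsPreconnected U)
    (hc : IsPreconnected Uᶜ) (hub : ∀ R : ℝ, ∃ z ∈ Uᶜ, R < ‖z‖) {g : ℂ → ℂ}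
    (hg : DifferentiableOn ℂ g U) : ∃ G : ℂ → ℂ, ∀ z ∈ U, HasDerivAt G (g z) z := by
  rcases U.eq_empty_or_nonempty with rfl | ⟨z0, hz0⟩
  · exact ⟨0, by simp⟩
  let K : ℕ → Set ℂ := fun n =>
    Metric.closedBall 0 (n + 1 : ℝ) ∩ (Metric.thickening (1 / (n + 1 : ℝ)) Uᶜ)ᶜ
  have hpos : ∀ n : ℕ, (0 : ℝ) < 1 / (n + 1 : ℝ) := fun n => by positivity
  have hKc : ∀ n, IsCompact (K n) := fun n =>
    (isCompact_closedBall _ _).inter_right Metric.isOpen_thickening.isClosed_compl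
  have hKU : ∀ n, K n ⊆ U := fun n z hz => by
    by_contra h
    exact hz.2 (Metric.self_subset_thickening (hpos n) _ h)
  have hKp : ∀ n, IsPreconnected (K n)ᶜ := fun n => by
    have e : (K n)ᶜ = {z : ℂ | (n + 1 : ℝ) < ‖z‖} ∪ Metric.thickening (1 / (n + 1 : ℝ)) Uᶜ := by
      ext z
      simp only [K, compl_inter, compl_compl, mem_union, mem_compl_iff, Metric.mem_closedBall,
        dist_zero_right, not_le, mem_setOf_eq]
    rw [e]
    obtain ⟨z, hz, hzn⟩ := hub (n + 1)
    exact (isPreconnected_norm_gt (by positivity)).union z hzn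
      (Metric.self_subset_thickening (hpos n) _ hz) (isPreconnected_thickening hc _)
  choose p hp using fun n => runge hU (hKc n) (hKU n) (hKp n) hg (hpos n)
  choose P hP0 hP using fun n =>
    ((p n).differentiable.isExactOn_univ).with_val_at z0 0
  have hloc : ∀ x ∈ U, ∃ δ > 0, Metric.ball x (4 * δ) ⊆ U ∧
      TendstoUniformlyOn (fun n z => (p n).eval z) g atTop (Metric.ball x (4 * δ)) := by
    intro x hx
    obtain ⟨d, hd, hb⟩ := Metric.isOpen_iff.1 hU x hx
    refine ⟨d / 8, by positivity, (Metric.ball_subset_ball (by linarith)).trans hb, ?_⟩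
    rw [Metric.tendstoUniformlyOn_iff]
    intro ε hε
    obtain ⟨N1, hN1⟩ := exists_nat_one_div_lt hε
    obtain ⟨N2, hN2⟩ := exists_nat_one_div_lt (show 0 < d / 2 by positivity)
    obtain ⟨N3, hN3⟩ := exists_nat_gt (‖x‖ + d)
    filter_upwards [eventually_ge_atTop N1, eventually_ge_atTop N2, eventually_ge_atTop N3]
      with n h1 h2 h3 z hz
    rw [Metric.mem_ball] at hz
    have h1' : 1 / (n + 1 : ℝ) ≤ 1 / (N1 + 1 : ℝ) := by gcongr
    have h2' : 1 / (n + 1 : ℝ) ≤ 1 / (N2 + 1 : ℝ) := by gcongr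
    have h3' : (N3 : ℝ) ≤ n := by exact_mod_cast h3
    have hzK : z ∈ K n := by
      refine ⟨?_, fun h => ?_⟩
      · rw [Metric.mem_closedBall, dist_zero_right]
        have := norm_le_norm_add_norm_sub' z x
        rw [dist_eq_norm] at hz
        linarith
      · obtain ⟨y, hy, hyz⟩ := Metric.mem_thickening_iff.1 h
        refine hy (hb ?_)
        rw [Metric.mem_ball]
        have := dist_triangle y z x
        rw [dist_comm y z] at this
        linarith
    rw [dist_comm, dist_eq_norm]
    exact (hp n z hzK).trans_le (by linarith)
  have hcau : ∀ x ∈ U, Cauchy (map (fun n => P n x) atTop) := by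
    intro x hx
    refine (hUc.induction₂ (fun x y => Cauchy (map (fun n => P n x) atTop) ↔
      Cauchy (map (fun n => P n y) atTop)) ?_ (fun x y z _ _ _ => Iff.trans)
      (fun x y _ _ => Iff.symm) hz0 hx).1 ?_
    · intro x hx
      obtain ⟨δ, hδ, hb, hu⟩ := hloc x hx
      refine mem_nhdsWithin_of_mem_nhds ?_
      filter_upwards [Metric.ball_mem_nhds x hδ] with y hy
      have hyx : Metric.ball y (2 * δ) ⊆ Metric.ball x (4 * δ) := by
        intro t ht
        rw [Metric.mem_ball] at *
        have := dist_triangle t y x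
        linarith
      constructor
      · intro h
        have := uniformCauchySeqOn_ball_of_deriv hu.uniformCauchySeqOn
          (fun n y _ => hP n y (mem_univ y)) h
        exact this.cauchy_map (by rw [Metric.mem_ball] at *; linarith)
      · intro h
        have := uniformCauchySeqOn_ball_of_deriv (hu.mono hyx).uniformCauchySeqOn
          (fun n y _ => hP n y (mem_univ y)) h
        exact this.cauchy_map (by rw [Metric.mem_ball] at *; rw [dist_comm]; linarith)
    · simp only [hP0]
      exact (tendsto_const_nhds (x := (0 : ℂ)) (f := (atTop : Filter ℕ))).cauchy_map
  have hlim : ∀ x, ∃ y, x ∈ U → Tendsto (fun n => P n x) atTop (𝓝 y) := by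
    intro x
    by_cases hx : x ∈ U
    · obtain ⟨y, hy⟩ := CompleteSpace.complete (hcau x hx)
      exact ⟨y, fun _ => hy⟩
    · exact ⟨0, fun h => absurd h hx⟩
  choose G hG using hlim
  refine ⟨G, fun z hz => ?_⟩
  obtain ⟨δ, hδ, hb, hu⟩ := hloc z hz
  exact hasDerivAt_of_tendstoUniformlyOn Metric.isOpen_ball hu
    (Eventually.of_forall fun n x _ => hP n x (mem_univ x)) (fun x hx => hG x (hb hx))
    (Metric.mem_ball_self (by positivity))

end


noncomputable section

open Set Filter Topology MeasureTheory

/-- Holomorphic functions on `U` have primitives. -/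
def HasPrims (U : Set ℂ) : Prop :=
  ∀ g : ℂ → ℂ, DifferentiableOn ℂ g U → ∃ G : ℂ → ℂ, ∀ z ∈ U, HasDerivAt G (g z) z

lemma HasPrims.exists_sqrt {U : Set ℂ} (hP : HasPrims U) (hU : IsOpen U) (hUc : IsPreconnected U)
    {f : ℂ → ℂ} (hf : DifferentiableOn ℂ f U) (h0 : ∀ z ∈ U, f z ≠ 0) :
    ∃ g : ℂ → ℂ, DifferentiableOn ℂ g U ∧ ∀ z ∈ U, g z ^ 2 = f z := by
  rcases U.eq_empty_or_nonempty with rfl | ⟨z0, hz0⟩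
  · exact ⟨f, hf, by simp⟩
  obtain ⟨G, hG⟩ := hP (fun z => deriv f z / f z) ((hf.deriv hU).div hf h0)
  have hfd : ∀ z ∈ U, HasDerivAt f (deriv f z) z := fun z hz =>
    ((hf z hz).differentiableAt (hU.mem_nhds hz)).hasDerivAt
  have hq : ∀ z ∈ U, HasDerivAt (fun z => f z * Complex.exp (-G z)) 0 z := by
    intro z hz
    have h1 := (hfd z hz).mul ((hG z hz).neg.cexp)
    refine h1.congr_deriv ?_
    have h2 := h0 z hz
    have h3 : f z * (Complex.exp (-G z) * -(deriv f z / f z)) = - (deriv f z * Complex.exp (-G z)) := by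
      field_simp
    change deriv f z * Complex.exp (-G z) + f z * (Complex.exp (-G z) * -(deriv f z / f z)) = 0
    rw [h3]
    ring
  have hc : ∀ z ∈ U, f z * Complex.exp (-G z) = f z0 * Complex.exp (-G z0) := by
    intro z hz
    exact hU.is_const_of_deriv_eq_zero hUc
      (fun z hz => (hq z hz).differentiableAt.differentiableWithinAt)
      (fun z hz => (hq z hz).deriv) hz hz0
  set c := f z0 * Complex.exp (-G z0) with hcdef
  obtain ⟨d, hd⟩ := IsAlgClosed.exists_pow_nat_eq c two_pos
  refine ⟨fun z => d * Complex.exp (G z / 2), fun z hz => ?_, fun z hz => ?_⟩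
  · exact (((hG z hz).div_const 2).cexp.const_mul d).differentiableAt.differentiableWithinAt
  · have h1 := hc z hz
    rw [mul_pow, hd, ← Complex.exp_nat_mul, ← h1, mul_assoc, ← Complex.exp_add]
    rw [Nat.cast_two]
    rw [show -G z + 2 * (G z / 2) = 0 by ring, Complex.exp_zero, mul_one]

/-- Disc automorphisms. -/
def psi (w z : ℂ) : ℂ := (z - w) / (1 - (starRingEnd ℂ) w * z)

lemma psi_denom {w z : ℂ} (hw : ‖w‖ < 1) (hz : ‖z‖ < 1) : 1 - (starRingEnd ℂ) w * z ≠ 0 := by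
  intro h
  have h1 : (starRingEnd ℂ) w * z = 1 := by linear_combination -h
  have h2 : ‖(starRingEnd ℂ) w * z‖ = 1 := by rw [h1]; simp
  rw [norm_mul, RCLike.norm_conj] at h2
  nlinarith [norm_nonneg w, norm_nonneg z]

lemma psi_norm_lt {w z : ℂ} (hw : ‖w‖ < 1) (hz : ‖z‖ < 1) : ‖psi w z‖ < 1 := by
  have hd := psi_denom hw hz
  rw [psi, norm_div, div_lt_one (norm_pos_iff.2 hd)]
  have h1 : ‖z - w‖ ^ 2 < ‖1 - (starRingEnd ℂ) w * z‖ ^ 2 := by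
    have hw2 : ‖w‖ ^ 2 < 1 := by nlinarith [norm_nonneg w]
    have hz2 : ‖z‖ ^ 2 < 1 := by nlinarith [norm_nonneg z]
    rw [← Complex.normSq_eq_norm_sq] at *
    rw [← Complex.normSq_eq_norm_sq] at *
    simp only [Complex.normSq_apply, Complex.sub_re, Complex.sub_im, Complex.mul_re, Complex.mul_im,
      Complex.conj_re, Complex.conj_im, Complex.one_re, Complex.one_im] at *
    nlinarith [mul_pos (sub_pos.2 hw2) (sub_pos.2 hz2)]
  exact lt_of_pow_lt_pow_left₀ 2 (norm_nonneg _) h1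

lemma conj_mul_ne_one {w : ℂ} (hw : ‖w‖ < 1) : 1 - (starRingEnd ℂ) w * w ≠ 0 := psi_denom hw hw

lemma psi_inj {w z z' : ℂ} (hw : ‖w‖ < 1) (hz : ‖z‖ < 1) (hz' : ‖z'‖ < 1)
    (h : psi w z = psi w z') : z = z' := by
  have hd := psi_denom hw hz
  have hd' := psi_denom hw hz'
  rw [psi, psi, div_eq_div_iff hd hd'] at h
  have : (z - z') * (1 - (starRingEnd ℂ) w * w) = 0 := by linear_combination h
  rcases mul_eq_zero.1 this with h | h
  · exact sub_eq_zero.1 h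
  · exact absurd h (conj_mul_ne_one hw)

lemma psi_hasDerivAt {w z : ℂ} (hw : ‖w‖ < 1) (hz : ‖z‖ < 1) :
    HasDerivAt (psi w) ((1 - (starRingEnd ℂ) w * w) / (1 - (starRingEnd ℂ) w * z) ^ 2) z := by
  have h := ((hasDerivAt_id z).sub_const w).div
    (((hasDerivAt_id z).const_mul ((starRingEnd ℂ) w)).const_sub 1) (psi_denom hw hz)
  refine h.congr_deriv ?_
  simp only [id]
  ring

lemma psi_eq_zero {w z : ℂ} (hw : ‖w‖ < 1) (hz : ‖z‖ < 1) (h : psi w z = 0) : z = w := by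
  rw [psi, div_eq_zero_iff] at h
  rcases h with h | h
  · exact sub_eq_zero.1 h
  · exact absurd h (psi_denom hw hz)

/-- Existence of a local uniform limit along the hyperfilter. -/
lemma montel {U : Set ℂ} (hU : IsOpen U) {F : ℕ → ℂ → ℂ} (hF : ∀ n, DifferentiableOn ℂ (F n) U)
    (hb : ∀ n, MapsTo (F n) U (Metric.ball 0 1)) :
    ∃ f : ℂ → ℂ, TendstoLocallyUniformlyOn F f (hyperfilter ℕ : Filter ℕ) U := by
  have h1 : ∀ z : ℂ, ∃ y : ℂ, z ∈ U → Tendsto (fun n => F n z) (hyperfilter ℕ : Filter ℕ) (𝓝 y) := by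
    intro z
    by_cases hz : z ∈ U
    · have hk : IsCompact (Metric.closedBall (0 : ℂ) 1) := isCompact_closedBall _ _
      obtain ⟨y, -, hy⟩ := hk.ultrafilter_le_nhds ((hyperfilter ℕ).map (fun n => F n z)) (by
        simp only [Ultrafilter.coe_map, le_principal_iff, mem_map]
        exact Filter.univ_mem' fun n => Metric.ball_subset_closedBall (hb n hz))
      exact ⟨y, fun _ => hy⟩
    · exact ⟨0, fun h => absurd h hz⟩
  choose f hf using h1
  refine ⟨f, ?_⟩
  rw [Metric.tendstoLocallyUniformlyOn_iff]
  intro ε hε x hx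
  obtain ⟨R, hR, hRU⟩ := Metric.isOpen_iff.1 hU x hx
  have hlip : ∀ n, ∀ y ∈ Metric.ball x R, dist (F n y) (F n x) ≤ 2 / R * dist y x := by
    intro n y hy
    refine Complex.dist_le_div_mul_dist_of_mapsTo_ball ((hF n).mono hRU) ?_ hy
    intro w hw
    have h1 := hb n (hRU hw)
    have h2 := hb n hx
    rw [Metric.mem_ball] at h1 h2
    rw [Metric.mem_closedBall]
    linarith [dist_triangle_right (F n w) (F n x) 0, Metric.mem_ball.1 (hb n hx)]
  have hlip' : ∀ y ∈ Metric.ball x R, dist (f y) (f x) ≤ 2 / R * dist y x := by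
    intro y hy
    exact le_of_tendsto ((hf y (hRU hy)).dist (hf x hx)) (Eventually.of_forall fun n => hlip n y hy)
  refine ⟨Metric.ball x (min R (ε * R / 8)), mem_nhdsWithin_of_mem_nhds
    (Metric.ball_mem_nhds _ (by positivity)), ?_⟩
  have h2 := (Metric.tendsto_nhds.1 (hf x hx)) (ε / 4) (by positivity)
  filter_upwards [h2] with n hn y hy
  rw [Metric.mem_ball, lt_min_iff] at hy
  have h3 := hlip n y hy.1
  have h4 := hlip' y hy.1
  have h5 : 2 / R * dist y x ≤ ε / 4 := by
    rw [div_mul_eq_mul_div, div_le_iff₀ hR]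
    linarith [hy.2]
  have h6 := dist_triangle4 (f y) (f x) (F n x) (F n y)
  rw [dist_comm (F n y)] at h3
  rw [dist_comm] at hn
  linarith

lemma hurwitz {U : Set ℂ} (hU : IsOpen U) (hUc : IsPreconnected U) {F : ℕ → ℂ → ℂ} {f : ℂ → ℂ}
    {φ : Filter ℕ} [φ.NeBot] (hF : ∀ n, DifferentiableOn ℂ (F n) U) (hi : ∀ n, InjOn (F n) U)
    (hlim : TendstoLocallyUniformlyOn F f φ U) {z0 : ℂ} (hz0 : z0 ∈ U) (hd : deriv f z0 ≠ 0) :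
    InjOn f U := by
  have hfd : DifferentiableOn ℂ f U := hlim.differentiableOn (Eventually.of_forall hF) hU
  intro a ha b hb hab
  by_contra hne
  have hh : AnalyticOnNhd ℂ (fun z => f z - f a) U := (hfd.sub_const (f a)).analyticOnNhd hU
  have hnz : ∀ᶠ z in 𝓝[≠] b, f z - f a ≠ 0 := by
    rcases (hh b hb).eventually_eq_zero_or_eventually_ne_zero with h | h
    · exfalso
      have h1 := hh.eqOn_zero_of_preconnected_of_eventuallyEq_zero hUc hb h
      apply hd
      have h2 : f =ᶠ[𝓝 z0] fun _ => f a := by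
        filter_upwards [hU.mem_nhds hz0] with z hz
        exact sub_eq_zero.1 (h1 hz)
      rw [h2.deriv_eq]
      simp
    · exact h
  rw [eventually_nhdsWithin_iff] at hnz
  have hnz2 : ∀ᶠ z in 𝓝 b, (z ≠ b → f z - f a ≠ 0) ∧ z ∈ U ∧ z ≠ a := by
    filter_upwards [hnz, hU.mem_nhds hb, isOpen_ne.mem_nhds (Ne.symm hne)] with z h1 h2 h3
    exact ⟨h1, h2, h3⟩
  obtain ⟨r, hr, hrs⟩ := Metric.nhds_basis_closedBall.mem_iff.1 hnz2
  have hUr : Metric.closedBall b r ⊆ U := fun z hz => (hrs hz).2.1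
  obtain ⟨δ, hδ, hδs⟩ : ∃ δ > 0, ∀ z ∈ Metric.sphere b r, δ ≤ ‖f z - f a‖ := by
    have hs : IsCompact (Metric.sphere b r) := isCompact_sphere _ _
    have hsn : (Metric.sphere b r).Nonempty := NormedSpace.sphere_nonempty.2 hr.le
    have hc : ContinuousOn (fun z => ‖f z - f a‖) (Metric.sphere b r) :=
      ((hh.continuousOn).mono (Metric.sphere_subset_closedBall.trans hUr)).norm
    obtain ⟨z, hz, hzm⟩ := hs.exists_isMinOn hsn hc
    refine ⟨‖f z - f a‖, norm_pos_iff.2 ((hrs (Metric.sphere_subset_closedBall hz)).1 ?_),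
      fun w hw => hzm hw⟩
    rintro rfl
    simp at hz
    exact hr.ne hz
  have hu := (tendstoLocallyUniformlyOn_iff_forall_isCompact hU).1 hlim _ hUr
    (isCompact_closedBall _ _)
  have hu2 := (tendstoLocallyUniformlyOn_iff_forall_isCompact hU).1 hlim {a} (by simpa using ha)
    isCompact_singleton
  obtain ⟨n, hn1, hn2⟩ := ((Metric.tendstoUniformlyOn_iff.1 hu (δ / 8) (by positivity)).and
    (Metric.tendstoUniformlyOn_iff.1 hu2 (δ / 8) (by positivity))).exists
  have hn2 := hn2 a rfl
  have key : ∀ z ∈ Metric.closedBall b r, ‖(F n z - F n a) - (f z - f a)‖ ≤ δ / 4 := by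
    intro z hz
    have h1 := hn1 z hz
    rw [dist_comm, dist_eq_norm] at h1
    rw [dist_eq_norm] at hn2
    calc ‖(F n z - F n a) - (f z - f a)‖ = ‖(F n z - f z) + (f a - F n a)‖ := by congr 1; ring
      _ ≤ _ := norm_add_le _ _
      _ ≤ _ := by linarith
  have hne0 : ∀ z ∈ Metric.closedBall b r, F n z - F n a ≠ 0 := by
    intro z hz h
    exact (hrs hz).2.2 (hi n (hUr hz) ha (sub_eq_zero.1 h))
  have hmax := Complex.norm_le_of_forall_mem_frontier_norm_le (U := Metric.ball b r)
    (f := fun z => (F n z - F n a)⁻¹) (C := (δ / 2)⁻¹) (z := b) Metric.isBounded_ball (by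
      apply DifferentiableOn.diffContOnCl
      rw [closure_ball b hr.ne']
      exact (((hF n).mono hUr).sub_const _).inv hne0) (by
      rw [frontier_ball b hr.ne']
      intro z hz
      rw [norm_inv]
      apply inv_anti₀ (by positivity)
      have h1 := key z (Metric.sphere_subset_closedBall hz)
      have h2 := hδs z hz
      have h3 := norm_sub_norm_le (f z - f a) (F n z - F n a)
      rw [norm_sub_rev (f z - f a) (F n z - F n a)] at h3
      linarith) (by rw [closure_ball b hr.ne']; exact Metric.mem_closedBall_self hr.le)
  rw [norm_inv] at hmax
  have h0 := hne0 b (Metric.mem_closedBall_self hr.le)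
  have h1 := (inv_le_inv₀ (norm_pos_iff.2 h0) (by positivity)).1 hmax
  have h2 := key b (Metric.mem_closedBall_self hr.le)
  rw [← hab, sub_self, sub_zero] at h2
  linarith
end


noncomputable section

open Set Filter Topology MeasureTheory

/-- Normalized univalent functions into the disc. -/
structure Univ (U : Set ℂ) (z0 : ℂ) (f : ℂ → ℂ) : Prop where
  diff : DifferentiableOn ℂ f U
  maps : ∀ z ∈ U, ‖f z‖ < 1
  inj : InjOn f U
  zero : f z0 = 0

lemma Univ.of_psi {U : Set ℂ} (hU : IsOpen U) {z0 : ℂ} (hz0 : z0 ∈ U) {f : ℂ → ℂ}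
    (hd : DifferentiableOn ℂ f U) (hm : ∀ z ∈ U, ‖f z‖ < 1) (hi : InjOn f U) :
    Univ U z0 (fun z => psi (f z0) (f z)) ∧
      deriv (fun z => psi (f z0) (f z)) z0 =
        1 / (1 - (starRingEnd ℂ) (f z0) * f z0) * deriv f z0 := by
  have h0 := hm z0 hz0
  have hD : ∀ z ∈ U, HasDerivAt (fun z => psi (f z0) (f z)) _ z := fun z hz =>
    (psi_hasDerivAt h0 (hm z hz)).comp z ((hd z hz).differentiableAt (hU.mem_nhds hz)).hasDerivAt
  refine ⟨⟨fun z hz => (hD z hz).differentiableAt.differentiableWithinAt,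
    fun z hz => psi_norm_lt h0 (hm z hz), fun z hz z' hz' h => hi hz hz' ?_, by simp [psi]⟩, ?_⟩
  · exact psi_inj h0 (hm z hz) (hm z' hz') h
  · rw [(hD z0 hz0).deriv]
    have := conj_mul_ne_one h0
    field_simp

lemma exists_univ {U : Set ℂ} (hP : HasPrims U) (hU : IsOpen U) (hUc : IsPreconnected U)
    (hne : U ≠ univ) {z0 : ℂ} (hz0 : z0 ∈ U) : ∃ f, Univ U z0 f ∧ deriv f z0 ≠ 0 := by
  obtain ⟨a, ha⟩ := (ne_univ_iff_exists_notMem U).1 hne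
  obtain ⟨s, hsd, hs⟩ := hP.exists_sqrt hU hUc (f := fun z => z - a) (by fun_prop)
    (fun z hz h => ha (by rwa [← sub_eq_zero.1 h]))
  have hs0 : ∀ z ∈ U, s z ≠ 0 := by
    intro z hz h
    have := hs z hz
    rw [h] at this
    apply ha
    have h2 : z = a := by linear_combination -this
    rwa [← h2]
  have hsD : ∀ z ∈ U, HasDerivAt s (deriv s z) z := fun z hz =>
    ((hsd z hz).differentiableAt (hU.mem_nhds hz)).hasDerivAt
  have hs' : deriv s z0 ≠ 0 := by
    intro h
    have h1 := (hsD z0 hz0).pow 2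
    have h2 : (s ^ 2) =ᶠ[𝓝 z0] fun z => z - a := by
      filter_upwards [hU.mem_nhds hz0] with z hz using hs z hz
    have h3 := h1.congr_of_eventuallyEq h2.symm
    have h4 := h3.unique ((hasDerivAt_id z0).sub_const a)
    simp [h] at h4
  have hinj : InjOn s U := by
    intro z hz w hw h
    have h1 := hs z hz
    have h2 := hs w hw
    rw [h, h2] at h1
    linear_combination -h1
  have hopen : s '' U ∈ 𝓝 (s z0) := by
    have han : AnalyticAt ℂ s z0 := hsd.analyticAt (hU.mem_nhds hz0)
    rw [← (han.hasStrictDerivAt).map_nhds_eq hs']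
    exact image_mem_map (hU.mem_nhds hz0)
  obtain ⟨ε, hε, hεs⟩ := Metric.nhds_basis_closedBall.mem_iff.1 hopen
  have hfar : ∀ z ∈ U, ε < ‖s z + s z0‖ := by
    intro z hz
    by_contra! hle
    have h1 : -s z ∈ Metric.closedBall (s z0) ε := by
      rw [Metric.mem_closedBall, dist_eq_norm, ← norm_neg]
      have e : -(-s z - s z0) = s z + s z0 := by ring
      rwa [e]
    obtain ⟨w, hw, hws⟩ := hεs h1
    have h2 := hs w hw
    rw [hws, neg_sq, hs z hz] at h2
    have h3 : z = w := by linear_combination h2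
    rw [← h3] at hws
    apply hs0 z hz
    linear_combination hws / 2
  have hne0 : ∀ z ∈ U, s z + s z0 ≠ 0 := fun z hz => norm_pos_iff.1 (hε.trans (hfar z hz))
  have hD : ∀ z ∈ U, HasDerivAt (fun z => (ε : ℂ) / (s z + s z0)) _ z := fun z hz =>
    (hasDerivAt_const z (ε : ℂ)).div ((hsD z hz).add_const (s z0)) (hne0 z hz)
  have hε' : (ε : ℂ) ≠ 0 := by exact_mod_cast hε.ne'
  obtain ⟨h1, h2⟩ := Univ.of_psi hU hz0 (f := fun z => (ε : ℂ) / (s z + s z0))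
    (fun z hz => (hD z hz).differentiableAt.differentiableWithinAt) (fun z hz => by
      rw [norm_div, div_lt_one (norm_pos_iff.2 (hne0 z hz))]
      simpa [abs_of_pos hε] using hfar z hz) (fun z hz w hw h => by
      apply hinj hz hw
      have h := h
      simp only at h
      rw [div_eq_div_iff (hne0 z hz) (hne0 w hw)] at h
      have := mul_left_cancel₀ hε' h
      linear_combination -this)
  refine ⟨_, h1, ?_⟩
  rw [h2, (hD z0 hz0).deriv]
  refine mul_ne_zero (one_div_ne_zero (conj_mul_ne_one ?_)) ?_
  · rw [norm_div, div_lt_one (norm_pos_iff.2 (hne0 z0 hz0))]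
    simpa [abs_of_pos hε] using hfar z0 hz0
  · refine div_ne_zero ?_ (pow_ne_zero _ (hne0 z0 hz0))
    simp [hε', hs']

lemma exists_extremal {U : Set ℂ} (hP : HasPrims U) (hU : IsOpen U) (hUc : IsPreconnected U)
    (hne : U ≠ univ) {z0 : ℂ} (hz0 : z0 ∈ U) :
    ∃ f, Univ U z0 f ∧ ∀ g, Univ U z0 g → ‖deriv g z0‖ ≤ ‖deriv f z0‖ := by
  obtain ⟨f0, hf0, hf0'⟩ := exists_univ hP hU hUc hne hz0
  obtain ⟨R, hR, hRU⟩ := Metric.isOpen_iff.1 hU z0 hz0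
  set S : Set ℝ := {x | ∃ g, Univ U z0 g ∧ ‖deriv g z0‖ = x} with hS
  have hbdd : BddAbove S := by
    refine ⟨1 / R, ?_⟩
    rintro x ⟨g, hg, rfl⟩
    refine Complex.norm_deriv_le_div_of_mapsTo_ball (hg.diff.mono hRU) ?_ hR
    intro z hz
    simpa [hg.zero] using (hg.maps z (hRU hz)).le
  have hSne : S.Nonempty := ⟨_, f0, hf0, rfl⟩
  have hseq : ∀ n : ℕ, ∃ g, Univ U z0 g ∧ sSup S - 1 / (n + 1) < ‖deriv g z0‖ := by
    intro n
    obtain ⟨x, ⟨g, hg, rfl⟩, hx⟩ := exists_lt_of_lt_csSup hSne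
      (show sSup S - 1 / ((n : ℝ) + 1) < sSup S by
        have : 0 < 1 / ((n : ℝ) + 1) := by positivity
        linarith)
    exact ⟨g, hg, hx⟩
  choose F hF hFs using hseq
  obtain ⟨f, hf⟩ := montel hU (fun n => (hF n).diff) (fun n z hz => by simpa using (hF n).maps z hz)
  have hfd : DifferentiableOn ℂ f U := hf.differentiableOn (Eventually.of_forall fun n => (hF n).diff) hU
  have hd := (hf.deriv (Eventually.of_forall fun n => (hF n).diff) hU)
  have hpt : Tendsto (fun n => ‖deriv (F n) z0‖) (hyperfilter ℕ : Filter ℕ) (𝓝 ‖deriv f z0‖) :=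
    (hd.tendsto_at hz0).norm
  have hsup : sSup S ≤ ‖deriv f z0‖ := by
    have h1 : Tendsto (fun n : ℕ => sSup S - 1 / ((n : ℝ) + 1)) (hyperfilter ℕ : Filter ℕ)
        (𝓝 (sSup S - 0)) :=
      (tendsto_const_nhds.sub tendsto_one_div_add_atTop_nhds_zero_nat).mono_left
        (by rw [← Nat.cofinite_eq_atTop]; exact hyperfilter_le_cofinite)
    rw [sub_zero] at h1
    exact le_of_tendsto_of_tendsto h1 hpt (Eventually.of_forall fun n => (hFs n).le)
  have hpos : deriv f z0 ≠ 0 := by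
    have : ‖deriv f0 z0‖ ≤ sSup S := le_csSup hbdd ⟨f0, hf0, rfl⟩
    have h2 : 0 < ‖deriv f0 z0‖ := norm_pos_iff.2 hf0'
    exact norm_pos_iff.1 (by linarith)
  have hz : f z0 = 0 := by
    have h1 := hf.tendsto_at hz0
    have h2 : Tendsto (fun n => F n z0) (hyperfilter ℕ : Filter ℕ) (𝓝 0) := by
      simp [(hF _).zero]
    exact tendsto_nhds_unique h1 h2
  have hle : ∀ z ∈ U, ‖f z‖ ≤ 1 := fun z hz =>
    le_of_tendsto (hf.tendsto_at hz).norm (Eventually.of_forall fun n => ((hF n).maps z hz).le)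
  have hlt : ∀ z ∈ U, ‖f z‖ < 1 := by
    intro z hzU
    by_contra! h
    have hm : IsMaxOn (norm ∘ f) U z := fun w hw => (hle w hw).trans h
    have h1 := Complex.norm_eqOn_of_isPreconnected_of_isMaxOn hUc hU hfd hzU hm hz0
    simp [hz] at h1
    rw [← h1] at h
    norm_num at h
  refine ⟨f, ⟨hfd, hlt, hurwitz hU hUc (fun n => (hF n).diff) (fun n => (hF n).inj) hf hz0 hpos, hz⟩,
    fun g hg => (le_csSup hbdd ⟨g, hg, rfl⟩).trans hsup⟩

theorem riemann_mapping {U : Set ℂ} (hP : HasPrims U) (hU : IsOpen U) (hUc : IsPreconnected U)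
    (hne : U ≠ univ) (hnon : U.Nonempty) :
    Nonempty (U ≃ₜ Metric.ball (0 : ℂ) 1) := by
  obtain ⟨z0, hz0⟩ := hnon
  obtain ⟨f, hf, hext⟩ := exists_extremal hP hU hUc hne hz0
  have hfpos : 0 < ‖deriv f z0‖ := by
    obtain ⟨f0, hf0, hf0'⟩ := exists_univ hP hU hUc hne hz0
    exact (norm_pos_iff.2 hf0').trans_le (hext _ hf0)
  have hfD : ∀ z ∈ U, HasDerivAt f (deriv f z) z := fun z hz =>
    ((hf.diff z hz).differentiableAt (hU.mem_nhds hz)).hasDerivAt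
  have hsurj : ∀ w : ℂ, ‖w‖ < 1 → ∃ z ∈ U, f z = w := by
    intro w hw
    by_contra! hno
    have hpD : ∀ z ∈ U, HasDerivAt (fun z => psi w (f z)) _ z := fun z hz =>
      (psi_hasDerivAt hw (hf.maps z hz)).comp z (hfD z hz)
    obtain ⟨g, hgd, hg⟩ := hP.exists_sqrt hU hUc (f := fun z => psi w (f z))
      (fun z hz => (hpD z hz).differentiableAt.differentiableWithinAt)
      (fun z hz h => hno z hz (psi_eq_zero hw (hf.maps z hz) h))
    have hgm : ∀ z ∈ U, ‖g z‖ < 1 := by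
      intro z hz
      have h1 : ‖g z‖ ^ 2 < 1 := by
        rw [← norm_pow, hg z hz]
        exact psi_norm_lt hw (hf.maps z hz)
      nlinarith [norm_nonneg (g z)]
    have hgi : InjOn g U := by
      intro z hz z' hz' h
      have h1 := hg z hz
      rw [h, hg z' hz'] at h1
      exact (hf.inj hz' hz (psi_inj hw (hf.maps z' hz') (hf.maps z hz) h1)).symm
    obtain ⟨hF, hF'⟩ := Univ.of_psi hU hz0 hgd hgm hgi
    have hle := hext _ hF
    rw [hF'] at hle
    have hgD : HasDerivAt g (deriv g z0) z0 :=
      ((hgd z0 hz0).differentiableAt (hU.mem_nhds hz0)).hasDerivAt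
    have h1 := hgD.pow 2
    have h2 : (g ^ 2) =ᶠ[𝓝 z0] fun z => psi w (f z) := by
      filter_upwards [hU.mem_nhds hz0] with z hz using hg z hz
    have h3 := (h1.congr_of_eventuallyEq h2.symm).unique (hpD z0 hz0)
    have h4 : g z0 ^ 2 = - w := by
      rw [hg z0 hz0, hf.zero]; simp [psi]
    rw [hf.zero] at h3
    simp only [mul_zero, sub_zero, one_pow, div_one] at h3
    set b := g z0 with hb
    have hb1 : ‖b‖ < 1 := hgm z0 hz0
    have hw2 : ‖w‖ = ‖b‖ ^ 2 := by rw [← norm_pow, h4, norm_neg]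
    have hb0 : 0 < ‖b‖ := by
      rw [norm_pos_iff]
      rintro h0
      apply hno z0 hz0
      rw [hf.zero]
      rw [h0] at h4
      linear_combination -h4
    have hn : ∀ v : ℂ, 1 - (starRingEnd ℂ) v * v = ((1 - ‖v‖ ^ 2 : ℝ) : ℂ) := by
      intro v
      rw [mul_comm, Complex.mul_conj, Complex.normSq_eq_norm_sq]
      push_cast; ring
    have h5 : 2 * ‖b‖ * ‖deriv g z0‖ = (1 - ‖w‖ ^ 2) * ‖deriv f z0‖ := by
      have h := congrArg norm h3
      rw [hn] at h
      simp only [norm_mul, norm_pow, Complex.norm_real, Real.norm_eq_abs] at h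
      rw [abs_of_pos (by nlinarith [norm_nonneg w])] at h
      simpa using h
    rw [hn, norm_mul, norm_div, norm_one, Complex.norm_real, Real.norm_eq_abs,
      abs_of_pos (by nlinarith), div_mul_eq_mul_div, one_mul, div_le_iff₀ (by nlinarith)] at hle
    rw [hw2] at h5
    have h6 : 2 * ‖b‖ * ‖deriv g z0‖ ≤ 2 * ‖b‖ * (‖deriv f z0‖ * (1 - ‖b‖ ^ 2)) := by gcongr
    rw [h5] at h6
    have h7 : 0 < ‖deriv f z0‖ * (1 - ‖b‖ ^ 2) * (1 - ‖b‖) ^ 2 := by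
      have : 0 < 1 - ‖b‖ := by linarith
      have : 0 < 1 - ‖b‖ ^ 2 := by nlinarith
      positivity
    nlinarith
  -- homeomorphism
  have hopen : ∀ s ⊆ U, IsOpen s → IsOpen (f '' s) := by
    rcases (hf.diff.analyticOnNhd hU).is_constant_or_isOpen hUc with ⟨w, hw⟩ | h
    · exfalso
      have h2 : f =ᶠ[𝓝 z0] fun _ => w := by
        filter_upwards [hU.mem_nhds hz0] with z hz using hw z hz
      rw [h2.deriv_eq] at hfpos
      simp at hfpos
    · exact h
  let φ : U → Metric.ball (0 : ℂ) 1 := fun z => ⟨f z, by simpa using hf.maps z z.2⟩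
  have hφc : Continuous φ := by
    apply Continuous.subtype_mk
    exact continuousOn_iff_continuous_domRestrict.1 hf.diff.continuousOn
  have hφi : Function.Injective φ := fun a b h =>
    Subtype.ext (hf.inj a.2 b.2 (congrArg Subtype.val h))
  have hφs : Function.Surjective φ := by
    rintro ⟨w, hw⟩
    obtain ⟨z, hz, hzw⟩ := hsurj w (by simpa using hw)
    exact ⟨⟨z, hz⟩, Subtype.ext hzw⟩
  have hφo : IsOpenMap φ := by
    intro s hs
    have h1 : IsOpen (Subtype.val '' s : Set ℂ) := hU.isOpenMap_subtype_val s hs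
    have h2 := hopen _ (by rintro _ ⟨x, -, rfl⟩; exact x.2) h1
    have h3 : φ '' s = Subtype.val ⁻¹' (f '' (Subtype.val '' s)) := by
      ext y
      constructor
      · rintro ⟨x, hx, rfl⟩
        exact ⟨x, ⟨x, hx, rfl⟩, rfl⟩
      · rintro ⟨_, ⟨x, hx, rfl⟩, h⟩
        exact ⟨x, hx, Subtype.ext h⟩
    rw [h3]
    exact h2.preimage continuous_subtype_val
  exact ⟨(Equiv.ofBijective φ ⟨hφi, hφs⟩).toHomeomorphOfContinuousOpen hφc hφo⟩

theorem homeo_complex {U : Set ℂ} (hU : IsOpen U) (hUc : IsPreconnected U) (hnon : U.Nonempty)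
    (hc : IsPreconnected Uᶜ) (hub : ∀ R : ℝ, ∃ z ∈ Uᶜ, R < ‖z‖) : Nonempty (U ≃ₜ ℂ) := by
  obtain ⟨φ⟩ := riemann_mapping (fun g hg => exists_primitive hU hUc hc hub hg) hU hUc
    (fun h => by obtain ⟨z, hz, -⟩ := hub 0; rw [h] at hz; simp at hz) hnon
  exact ⟨φ.trans (Homeomorph.unitBall (E := ℂ)).symm⟩
end


noncomputable section

open Set Filter Topology MeasureTheory

lemma exp_one_const {X : Type*} [TopologicalSpace X] {S : Set X} (hS : IsPreconnected S) {v : X → ℂ}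
    (hv : ContinuousOn v S) (h1 : ∀ x ∈ S, Complex.exp (v x) = 1) :
    ∃ n : ℤ, ∀ x ∈ S, v x = n * (2 * Real.pi * Complex.I) := by
  have h2 : ∀ x ∈ S, ∃ n : ℤ, v x = n * (2 * Real.pi * Complex.I) := fun x hx =>
    Complex.exp_eq_one_iff.1 (h1 x hx)
  rcases S.eq_empty_or_nonempty with rfl | ⟨x0, hx0⟩
  · exact ⟨0, by simp⟩
  obtain ⟨n, hn⟩ := h2 x0 hx0
  refine ⟨n, fun x hx => ?_⟩
  obtain ⟨m, hm⟩ := h2 x hx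
  have hpi := Real.pi_pos
  set g : X → ℝ := fun x => (v x).im / (2 * Real.pi) with hg
  have hgc : ContinuousOn g S := (Complex.continuous_im.comp_continuousOn hv).div_const _
  have hgv : ∀ (x : X) (k : ℤ), v x = k * (2 * Real.pi * Complex.I) → g x = k := by
    intro x k hk
    simp only [hg, hk]
    simp
  have hgo : OrdConnected (g '' S) := (hS.image g hgc).ordConnected
  have key : ∀ a b : ℤ, (a : ℝ) ∈ g '' S → (b : ℝ) ∈ g '' S → ¬ a < b := by
    intro a b ha hb hab
    have hab' : (a : ℝ) + 1 ≤ b := by exact_mod_cast hab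
    have h3 : (a : ℝ) + 1 / 2 ∈ g '' S := hgo.out ha hb ⟨by linarith, by linarith⟩
    obtain ⟨y, hy, hya⟩ := h3
    obtain ⟨k, hk⟩ := h2 y hy
    rw [hgv y k hk] at hya
    have h4 : ((2 * k : ℤ) : ℝ) = ((2 * a + 1 : ℤ) : ℝ) := by push_cast; linarith
    have h5 : 2 * k = 2 * a + 1 := by exact_mod_cast h4
    omega
  have h3 : (n : ℝ) ∈ g '' S := ⟨x0, hx0, hgv _ _ hn⟩
  have h4 : (m : ℝ) ∈ g '' S := ⟨x, hx, hgv _ _ hm⟩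
  have h5 : m = n := le_antisymm (not_lt.1 (key _ _ h3 h4)) (not_lt.1 (key _ _ h4 h3))
  rw [hm, h5]

lemma exists_log_univ {f : ℂ × ℝ → ℂ} (hf : Continuous f) (h0 : ∀ p, f p ≠ 0) :
    ∃ u : ℂ × ℝ → ℂ, Continuous u ∧ ∀ p, Complex.exp (u p) = f p := by
  obtain ⟨u, hu, hu2⟩ := Complex.exists_continuousOn_eqOn_exp_comp (X := ℂ × ℝ) (U := univ)
    (g := f) (by
      have h := (convex_univ : Convex ℝ (univ : Set (ℂ × ℝ))).contractibleSpace ⟨0, mem_univ _⟩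
      exact SimplyConnectedSpace.ofContractible _) isOpen_univ hf.continuousOn (by simpa using h0)
  exact ⟨u, continuousOn_univ.1 hu, fun p => hu2 (mem_univ p)⟩

lemma glue {X Y : Type*} [TopologicalSpace X] [TopologicalSpace Y] {A B : Set X} (hA : IsOpen A)
    (hB : IsOpen B) {u v : X → Y} (hu : ContinuousOn u A) (hv : ContinuousOn v B)
    (h : ∀ x ∈ A, x ∈ B → u x = v x) :
    ∃ w : X → Y, ContinuousOn w (A ∪ B) ∧ (∀ x ∈ A, w x = u x) ∧ ∀ x ∈ B, w x = v x := by
  classical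
  have h1 : ∀ x ∈ A, A.piecewise u v x = u x := fun x hx => by simp [hx]
  have h2 : ∀ x ∈ B, A.piecewise u v x = v x := fun x hx => by
    by_cases hxA : x ∈ A
    · rw [h1 x hxA, h x hxA hx]
    · simp [hxA]
  refine ⟨A.piecewise u v, ?_, h1, h2⟩
  exact (hu.congr h1).union_of_isOpen (hv.congr h2) hA hB

/-- Functions on `ℂ* × ℝ`. -/
lemma model_repr {f : ℂ × ℝ → ℂ} (hf : ContinuousOn f {p | p.1 ≠ 0})
    (h0 : ∀ p : ℂ × ℝ, p.1 ≠ 0 → f p ≠ 0) :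
    ∃ (n : ℤ) (u : ℂ × ℝ → ℂ), ContinuousOn u {p | p.1 ≠ 0} ∧
      ∀ p : ℂ × ℝ, p.1 ≠ 0 → f p = p.1 ^ n * Complex.exp (u p) := by
  have hmap : Continuous (fun p : ℂ × ℝ => (Complex.exp p.1, p.2)) := by fun_prop
  obtain ⟨v, hv, hvf⟩ := exists_log_univ (f := fun p => f (Complex.exp p.1, p.2))
    (hf.comp_continuous hmap fun p => Complex.exp_ne_zero _)
    (fun p => h0 _ (Complex.exp_ne_zero _))
  obtain ⟨n, hn⟩ := exp_one_const (S := univ) (v := fun p : ℂ × ℝ =>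
    v (p.1 + 2 * Real.pi * Complex.I, p.2) - v p) isPreconnected_univ
    (by fun_prop) (fun p _ => by
      rw [Complex.exp_sub, hvf, hvf]
      simp only [Complex.exp_periodic p.1]
      exact div_self (h0 _ (Complex.exp_ne_zero _)))
  set w : ℂ × ℝ → ℂ := fun p => v p - n * p.1 with hw
  have hwc : Continuous w := by fun_prop
  have hper : ∀ z s, w (z + 2 * Real.pi * Complex.I, s) = w (z, s) := by
    intro z s
    have := hn (z, s) (mem_univ _)
    simp only [hw] at this ⊢
    linear_combination this
  have hperk : ∀ (k : ℕ) z s, w (z + k * (2 * Real.pi * Complex.I), s) = w (z, s) := by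
    intro k
    induction k with
    | zero => intro z s; simp
    | succ k ih =>
      intro z s
      rw [← ih z s, ← hper (z + k * (2 * Real.pi * Complex.I))]
      congr 2
      push_cast; ring
  have hperz : ∀ (k : ℤ) z s, w (z + k * (2 * Real.pi * Complex.I), s) = w (z, s) := by
    intro k z s
    obtain ⟨m, rfl | rfl⟩ := k.eq_nat_or_neg
    · exact_mod_cast hperk m z s
    · rw [← hperk m]
      congr 2
      push_cast; ring
  have hexp : ∀ z z' s, Complex.exp z = Complex.exp z' → w (z, s) = w (z', s) := by
    intro z z' s h
    obtain ⟨k, hk⟩ := Complex.exp_eq_exp_iff_exists_int.1 h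
    rw [hk, hperz]
  refine ⟨n, fun p => w (Complex.log p.1, p.2), ?_, ?_⟩
  · intro p hp
    apply ContinuousAt.continuousWithinAt
    by_cases hs : p.1 ∈ Complex.slitPlane
    · have h1 : ContinuousAt (fun p : ℂ × ℝ => (Complex.log p.1, p.2)) p :=
        (continuousAt_fst.clog hs).prodMk continuousAt_snd
      exact hwc.continuousAt.comp h1
    · have hs' : -p.1 ∈ Complex.slitPlane := by
        rw [Complex.mem_slitPlane_iff] at hs ⊢
        push Not at hs
        left
        have : p.1.re ≠ 0 := fun h => hp (Complex.ext h hs.2)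
        simp only [Complex.neg_re]
        exact neg_pos.2 (lt_of_le_of_ne hs.1 this)
      have h1 : ContinuousAt (fun p : ℂ × ℝ => (Complex.log (-p.1) + Real.pi * Complex.I, p.2)) p :=
        ((continuousAt_fst.neg.clog hs').add_const _).prodMk continuousAt_snd
      have h2 : ContinuousAt (fun p : ℂ × ℝ => w (Complex.log (-p.1) + Real.pi * Complex.I, p.2)) p :=
        hwc.continuousAt.comp h1
      refine h2.congr ?_
      have hopen : IsOpen {p : ℂ × ℝ | p.1 ≠ 0} := isOpen_ne.preimage continuous_fst
      filter_upwards [hopen.mem_nhds hp] with q hq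
      apply hexp
      rw [Complex.exp_add, Complex.exp_log (neg_ne_zero.2 hq), Complex.exp_log hq,
        Complex.exp_pi_mul_I]
      ring
  · intro p hp
    have h1 := hvf (Complex.log p.1, p.2)
    simp only [Complex.exp_log hp] at h1
    simp only [hw]
    rw [Complex.exp_sub, Complex.exp_int_mul, Complex.exp_log hp, ← h1]
    have := zpow_ne_zero n hp
    field_simp

lemma model_no_log : ¬ ∃ u : ℂ × ℝ → ℂ, ContinuousOn u {p | p.1 ≠ 0} ∧
    ∀ p : ℂ × ℝ, p.1 ≠ 0 → Complex.exp (u p) = p.1 := by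
  rintro ⟨u, hu, hue⟩
  have hc : Continuous (fun z : ℂ => u (Complex.exp z, 0) - z) := by
    refine Continuous.sub (hu.comp_continuous (by fun_prop) fun p => Complex.exp_ne_zero _)
      continuous_id
  obtain ⟨n, hn⟩ := exp_one_const (S := univ) isPreconnected_univ hc.continuousOn (fun z _ => by
    rw [Complex.exp_sub, hue _ (Complex.exp_ne_zero _)]
    exact div_self (Complex.exp_ne_zero _))
  have h1 := hn 0 (mem_univ _)
  have h2 := hn (2 * Real.pi * Complex.I) (mem_univ _)
  rw [Complex.exp_two_pi_mul_I] at h2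
  rw [Complex.exp_zero] at h1
  have h3 : (2 * Real.pi * Complex.I : ℂ) = 0 := by linear_combination h1 - h2
  exact Complex.two_pi_I_ne_zero h3
end


noncomputable section

open Set Filter Topology MeasureTheory

/-- The complement of `L × {0}`, described by the distance function `δ`. -/
def upS (δ : ℂ → ℝ) : Set (ℂ × ℝ) := {p | -δ p.1 < p.2}
/-- The lower part. -/
def dnS (δ : ℂ → ℝ) : Set (ℂ × ℝ) := {p | p.2 < δ p.1}

lemma upS_open {δ : ℂ → ℝ} (hδ : Continuous δ) : IsOpen (upS δ) :=
  isOpen_lt (by fun_prop) (by fun_prop)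
lemma dnS_open {δ : ℂ → ℝ} (hδ : Continuous δ) : IsOpen (dnS δ) :=
  isOpen_lt (by fun_prop) (by fun_prop)

lemma upS_preconn {δ : ℂ → ℝ} (hδ : Continuous δ) : IsPreconnected (upS δ) := by
  have h : upS δ = range (fun p : ℂ × ℝ => (p.1, Real.exp p.2 - δ p.1)) := by
    ext ⟨x, t⟩
    simp only [upS, mem_range, Prod.mk.injEq, Prod.exists]
    constructor
    · intro h
      have h : -δ x < t := h
      refine ⟨x, Real.log (t + δ x), rfl, ?_⟩
      rw [Real.exp_log (by linarith)]; ring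
    · rintro ⟨y, s, rfl, rfl⟩
      change -δ y < Real.exp s - δ y
      linarith [Real.exp_pos s]
  rw [h]
  exact isPreconnected_range (by fun_prop)

lemma dnS_preconn {δ : ℂ → ℝ} (hδ : Continuous δ) : IsPreconnected (dnS δ) := by
  have h : dnS δ = (fun p : ℂ × ℝ => (p.1, -p.2)) '' upS δ := by
    ext ⟨x, t⟩
    constructor
    · intro h
      refine ⟨(x, -t), ?_, by simp⟩
      have h : t < δ x := h
      change -δ x < -t
      linarith
    · rintro ⟨⟨y, s⟩, hp, h⟩
      simp only [Prod.mk.injEq] at h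
      obtain ⟨rfl, rfl⟩ := h
      have hp : -δ y < s := hp
      change -s < δ y
      linarith
  rw [h]
  exact (upS_preconn hδ).image _ (by fun_prop)

lemma upS_log {δ : ℂ → ℝ} (hδ : Continuous δ) {f : ℂ × ℝ → ℂ} (hf : ContinuousOn f (upS δ))
    (h0 : ∀ p ∈ upS δ, f p ≠ 0) :
    ∃ u : ℂ × ℝ → ℂ, ContinuousOn u (upS δ) ∧ ∀ p ∈ upS δ, Complex.exp (u p) = f p := by
  have hm : ∀ p : ℂ × ℝ, (p.1, Real.exp p.2 - δ p.1) ∈ upS δ := fun p => by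
    change -δ p.1 < Real.exp p.2 - δ p.1
    linarith [Real.exp_pos p.2]
  obtain ⟨v, hv, hve⟩ := exists_log_univ (f := fun p => f (p.1, Real.exp p.2 - δ p.1))
    (hf.comp_continuous (by fun_prop) hm) (fun p => h0 _ (hm p))
  refine ⟨fun p => v (p.1, Real.log (p.2 + δ p.1)), ?_, ?_⟩
  · apply hv.comp_continuousOn
    refine continuous_fst.continuousOn.prodMk (ContinuousOn.log (by fun_prop) ?_)
    intro p hp
    have hp : -δ p.1 < p.2 := hp
    linarith
  · intro p hp
    have hp : -δ p.1 < p.2 := hp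
    rw [hve]
    simp only
    rw [Real.exp_log (by linarith)]
    simp

lemma dnS_log {δ : ℂ → ℝ} (hδ : Continuous δ) {f : ℂ × ℝ → ℂ} (hf : ContinuousOn f (dnS δ))
    (h0 : ∀ p ∈ dnS δ, f p ≠ 0) :
    ∃ u : ℂ × ℝ → ℂ, ContinuousOn u (dnS δ) ∧ ∀ p ∈ dnS δ, Complex.exp (u p) = f p := by
  have hm : ∀ p ∈ upS δ, (p.1, -p.2) ∈ dnS δ := fun p hp => by
    have hp : -δ p.1 < p.2 := hp
    change -p.2 < δ p.1
    linarith
  have hm' : ∀ p ∈ dnS δ, (p.1, -p.2) ∈ upS δ := fun p hp => by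
    have hp : p.2 < δ p.1 := hp
    change -δ p.1 < -p.2
    linarith
  obtain ⟨v, hv, hve⟩ := upS_log hδ (f := fun p => f (p.1, -p.2))
    (hf.comp (by fun_prop) hm) (fun p hp => h0 _ (hm p hp))
  refine ⟨fun p => v (p.1, -p.2), hv.comp (by fun_prop) hm', fun p hp => ?_⟩
  rw [hve _ (hm' p hp)]
  simp

/-- The open set `V` is a union of components of the complement of the zero set of `δ`. -/
structure Piece (δ : ℂ → ℝ) (V : Set ℂ) : Prop where
  isOpen : IsOpen V
  pos : ∀ x ∈ V, 0 < δ x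
  compl : IsOpen {x | 0 < δ x ∧ x ∉ V}

open Classical in
/-- Transition function. -/
def sig (δ : ℂ → ℝ) (V : Set ℂ) (p : ℂ × ℝ) : ℝ :=
  if p.1 ∈ V then (1 - max (-1) (min 1 (p.2 / δ p.1))) / 2 else 0

open Classical in
/-- Indicator. -/
def ind (V : Set ℂ) (x : ℂ) : ℤ := if x ∈ V then 1 else 0

lemma sig_cont {δ : ℂ → ℝ} (hδ : Continuous δ) (h0 : ∀ x, 0 ≤ δ x) {V : Set ℂ} (hV : Piece δ V) :
    ContinuousOn (sig δ V) (upS δ) := by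
  intro p hp
  apply ContinuousAt.continuousWithinAt
  by_cases hpV : p.1 ∈ V
  · have h1 : ContinuousAt (fun p : ℂ × ℝ => (1 - max (-1) (min 1 (p.2 / δ p.1))) / 2) p := by
      have : ContinuousAt (fun p : ℂ × ℝ => p.2 / δ p.1) p :=
        continuousAt_snd.div (by fun_prop) (hV.pos _ hpV).ne'
      fun_prop
    refine h1.congr ?_
    filter_upwards [(hV.isOpen.preimage continuous_fst).mem_nhds hpV] with q hq
    have hq : q.1 ∈ V := hq
    simp [sig, hq]
  · have h1 : sig δ V =ᶠ[𝓝 p] fun _ => 0 := by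
      by_cases hd : 0 < δ p.1
      · filter_upwards [(hV.compl.preimage continuous_fst).mem_nhds ⟨hd, hpV⟩] with q hq
        have hq : q.1 ∉ V := hq.2
        simp [sig, hq]
      · have hd0 : δ p.1 = 0 := le_antisymm (not_lt.1 hd) (h0 _)
        have hp : -δ p.1 < p.2 := hp
        have ho : IsOpen {q : ℂ × ℝ | δ q.1 < q.2} := isOpen_lt (by fun_prop) (by fun_prop)
        filter_upwards [ho.mem_nhds (show δ p.1 < p.2 by linarith)] with q hq
        have hq : δ q.1 < q.2 := hq
        by_cases hqV : q.1 ∈ V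
        · have h2 : 1 ≤ q.2 / δ q.1 := by
            rw [le_div_iff₀ (hV.pos _ hqV)]; linarith
          simp [sig, hqV, min_eq_left h2]
        · simp [sig, hqV]
    exact (continuousAt_const).congr h1.symm

lemma sig_cont' {δ : ℂ → ℝ} (hδ : Continuous δ) (h0 : ∀ x, 0 ≤ δ x) {V : Set ℂ} (hV : Piece δ V) :
    ContinuousOn (fun p => sig δ V p - ind V p.1) (dnS δ) := by
  have h1 : ∀ p : ℂ × ℝ, sig δ V p - ind V p.1 = - sig δ V (p.1, -p.2) := by
    intro p
    by_cases hp : p.1 ∈ V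
    · simp only [sig, ind, hp, if_true]
      have : max (-1) (min 1 (-p.2 / δ p.1)) = - max (-1) (min 1 (p.2 / δ p.1)) := by
        rw [neg_div]
        rw [← min_neg_neg, neg_neg, ← max_neg_neg 1 (p.2 / δ p.1)]
        rw [max_min_distrib_left, max_eq_right (by norm_num : (-1 : ℝ) ≤ 1)]
      rw [this]
      push_cast; ring
    · simp [sig, ind, hp]
  simp only [h1]
  refine ((sig_cont hδ h0 hV).comp (by fun_prop) ?_).neg
  intro p hp
  have hp : p.2 < δ p.1 := hp
  change -δ p.1 < -p.2
  linarith

/-- The function on the complement of `L × {0}` associated with `V`. -/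
def fV (δ : ℂ → ℝ) (V : Set ℂ) (p : ℂ × ℝ) : ℂ :=
  Complex.exp ((sig δ V p : ℂ) * (2 * Real.pi * Complex.I))

lemma fV_eq (δ : ℂ → ℝ) (V : Set ℂ) (p : ℂ × ℝ) : fV δ V p =
    Complex.exp (((sig δ V p - ind V p.1 : ℝ) : ℂ) * (2 * Real.pi * Complex.I)) := by
  rw [fV, Complex.exp_eq_exp_iff_exists_int]
  exact ⟨ind V p.1, by push_cast; ring⟩

lemma fV_cont {δ : ℂ → ℝ} (hδ : Continuous δ) (h0 : ∀ x, 0 ≤ δ x) {V : Set ℂ} (hV : Piece δ V) :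
    ContinuousOn (fV δ V) (upS δ ∪ dnS δ) := by
  refine ContinuousOn.union_of_isOpen ?_ ?_ (upS_open hδ) (dnS_open hδ)
  · exact ((Complex.continuous_ofReal.comp_continuousOn (sig_cont hδ h0 hV)).mul_const _).cexp
  · have h := ((Complex.continuous_ofReal.comp_continuousOn (sig_cont' hδ h0 hV)).mul_const
      (2 * Real.pi * Complex.I)).cexp
    refine h.congr fun p hp => fV_eq δ V p

lemma const_of_log {δ : ℂ → ℝ} (hδ : Continuous δ) (h0 : ∀ x, 0 ≤ δ x) {V V' : Set ℂ}
    (hV : Piece δ V) (hV' : Piece δ V') (a b : ℤ) {u : ℂ × ℝ → ℂ}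
    (hu : ContinuousOn u (upS δ ∪ dnS δ))
    (hue : ∀ p ∈ upS δ ∪ dnS δ, Complex.exp (u p) = fV δ V p ^ a * fV δ V' p ^ b) :
    ∃ c : ℤ, ∀ x, 0 < δ x → a * ind V x + b * ind V' x = c := by
  obtain ⟨m, hm⟩ := exp_one_const (v := fun p => a * ((sig δ V p : ℂ) * (2 * Real.pi * Complex.I)) +
    b * ((sig δ V' p : ℂ) * (2 * Real.pi * Complex.I)) - u p) (upS_preconn hδ) (by
      have h1 := Complex.continuous_ofReal.comp_continuousOn (sig_cont hδ h0 hV)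
      have h2 := Complex.continuous_ofReal.comp_continuousOn (sig_cont hδ h0 hV')
      exact (((h1.mul_const _).const_mul _).add ((h2.mul_const _).const_mul _)).sub
        (hu.mono subset_union_left)) (by
      intro p hp
      have := hue p (Or.inl hp)
      rw [Complex.exp_sub, Complex.exp_add, Complex.exp_int_mul, Complex.exp_int_mul, this]
      exact div_self (mul_ne_zero (zpow_ne_zero _ (Complex.exp_ne_zero _))
        (zpow_ne_zero _ (Complex.exp_ne_zero _))))
  obtain ⟨k, hk⟩ := exp_one_const (v := fun p =>
    a * (((sig δ V p - ind V p.1 : ℝ) : ℂ) * (2 * Real.pi * Complex.I)) +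
    b * (((sig δ V' p - ind V' p.1 : ℝ) : ℂ) * (2 * Real.pi * Complex.I)) - u p)
    (dnS_preconn hδ) (by
      have h1 := Complex.continuous_ofReal.comp_continuousOn (sig_cont' hδ h0 hV)
      have h2 := Complex.continuous_ofReal.comp_continuousOn (sig_cont' hδ h0 hV')
      exact (((h1.mul_const _).const_mul _).add ((h2.mul_const _).const_mul _)).sub
        (hu.mono subset_union_right)) (by
      intro p hp
      have := hue p (Or.inr hp)
      rw [Complex.exp_sub, Complex.exp_add, Complex.exp_int_mul, Complex.exp_int_mul,
        ← fV_eq, ← fV_eq, this]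
      exact div_self (by rw [← this]; exact Complex.exp_ne_zero _))
  refine ⟨m - k, fun x hx => ?_⟩
  have h1 := hm (x, 0) (show -δ x < 0 by linarith)
  have h2 := hk (x, 0) (show 0 < δ x from hx)
  have h3 : ((a * ind V x + b * ind V' x : ℤ) : ℂ) * (2 * Real.pi * Complex.I) =
      ((m - k : ℤ) : ℂ) * (2 * Real.pi * Complex.I) := by
    push_cast at h1 h2 ⊢
    linear_combination h1 - h2
  exact_mod_cast mul_right_cancel₀ Complex.two_pi_I_ne_zero h3

/-- If the complement is preconnected, all functions have logs. -/
lemma log_of_preconn {δ : ℂ → ℝ} (hδ : Continuous δ) (hc : IsPreconnected {x | 0 < δ x})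
    {f : ℂ × ℝ → ℂ} (hf : ContinuousOn f (upS δ ∪ dnS δ)) (hf0 : ∀ p ∈ upS δ ∪ dnS δ, f p ≠ 0) :
    ∃ u : ℂ × ℝ → ℂ, ContinuousOn u (upS δ ∪ dnS δ) ∧
      ∀ p ∈ upS δ ∪ dnS δ, Complex.exp (u p) = f p := by
  obtain ⟨u, hu, hue⟩ := upS_log hδ (hf.mono subset_union_left) (fun p hp => hf0 p (Or.inl hp))
  obtain ⟨v, hv, hve⟩ := dnS_log hδ (hf.mono subset_union_right) (fun p hp => hf0 p (Or.inr hp))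
  have hO : IsPreconnected (upS δ ∩ dnS δ) := by
    have h : upS δ ∩ dnS δ = (fun p : ℂ × ℝ => (p.1, p.2 * δ p.1)) '' ({x | 0 < δ x} ×ˢ Ioo (-1) 1) := by
      ext ⟨x, t⟩
      constructor
      · rintro ⟨h1, h2⟩
        have h1 : -δ x < t := h1
        have h2 : t < δ x := h2
        have h3 : 0 < δ x := by linarith
        refine ⟨(x, t / δ x), ⟨h3, ?_, ?_⟩, ?_⟩
        · simp only; rw [lt_div_iff₀ h3]; linarith
        · simp only; rw [div_lt_iff₀ h3]; linarith
        · simp [h3.ne']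
      · rintro ⟨⟨y, s⟩, ⟨h1, h2, h3⟩, h⟩
        simp only [Prod.mk.injEq] at h h1 h2 h3
        obtain ⟨rfl, rfl⟩ := h
        have h1 : 0 < δ y := h1
        constructor
        · change -δ y < s * δ y
          nlinarith
        · change s * δ y < δ y
          nlinarith
    rw [h]
    exact (hc.prod isPreconnected_Ioo).image _ (by fun_prop)
  obtain ⟨n, hn⟩ := exp_one_const (v := fun p => u p - v p) hO
    ((hu.mono inter_subset_left).sub (hv.mono inter_subset_right)) (fun p hp => by
      rw [Complex.exp_sub, hue p hp.1, hve p hp.2]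
      exact div_self (hf0 p (Or.inl hp.1)))
  obtain ⟨w, hw, hw1, hw2⟩ := glue (upS_open hδ) (dnS_open hδ) hu
    (hv.add (continuousOn_const (c := (n * (2 * Real.pi * Complex.I) : ℂ)))) (fun p h1 h2 => by
      have := hn p ⟨h1, h2⟩
      simp only [Pi.add_apply]
      linear_combination this)
  refine ⟨w, hw, ?_⟩
  rintro p (hp | hp)
  · rw [hw1 p hp, hue p hp]
  · rw [hw2 p hp, Pi.add_apply, Complex.exp_add, Complex.exp_int_mul_two_pi_mul_I, mul_one, hve p hp]
end


noncomputable section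

open Set Filter Topology MeasureTheory

/-- The straightened complement: functions on it. -/
lemma line_straighten {L : Set ℂ} (hL : IsClosed L) (e : ℝ ≃ₜ L) :
    ∃ Φ Ψ : ℂ × ℝ → ℂ × ℝ, Continuous Φ ∧ Continuous Ψ ∧ (∀ p, Ψ (Φ p) = p) ∧ (∀ p, Φ (Ψ p) = p) ∧
      ∀ p, (Φ p).1 = 0 ↔ (p.1 ∈ L ∧ p.2 = 0) := by
  obtain ⟨H, hH⟩ := ContinuousMap.exists_restrict_eq hL (⟨e.symm, e.symm.continuous⟩ : C(L, ℝ))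
  have hHL : ∀ x : L, H x = e.symm x := fun x => by
    have := DFunLike.congr_fun hH x
    simpa using this
  set γ : ℝ → ℂ := fun s => (e s : ℂ) with hγ
  have hγc : Continuous γ := continuous_subtype_val.comp e.continuous
  have hHγ : ∀ s, H (γ s) = s := fun s => by
    have := hHL (e s)
    simpa using this
  have hHc : Continuous H := H.continuous
  refine ⟨fun p => (p.1 - γ (p.2 + H p.1), p.2 + H p.1),
    fun q => (q.1 + γ q.2, q.2 - H (q.1 + γ q.2)), by fun_prop, by fun_prop, ?_, ?_, ?_⟩
  · rintro ⟨x, t⟩; simp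
  · rintro ⟨x, t⟩; simp
  · rintro ⟨x, t⟩
    simp only
    constructor
    · intro h
      have h1 : x = γ (t + H x) := sub_eq_zero.1 h
      have h2 : H x = t + H x := by
        conv_lhs => rw [h1]
        exact hHγ _
      refine ⟨?_, by linarith⟩
      rw [h1]
      exact (e _).2
    · rintro ⟨h1, rfl⟩
      have := hHL ⟨x, h1⟩
      simp only at this
      rw [zero_add, this, hγ]
      simp

lemma split_of_not_preconn {S : Set ℂ} (hS : IsOpen S) (h : ¬ IsPreconnected S) :
    ∃ A B : Set ℂ, IsOpen A ∧ IsOpen B ∧ A.Nonempty ∧ B.Nonempty ∧ Disjoint A B ∧ A ∪ B = S := by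
  rw [IsPreconnected] at h
  push Not at h
  obtain ⟨u, v, hu, hv, hsub, hun, hvn, huv⟩ := h
  refine ⟨S ∩ u, S ∩ v, hS.inter hu, hS.inter hv, hun, hvn, ?_, ?_⟩
  · rw [disjoint_left]
    rintro x ⟨h1, h2⟩ ⟨-, h3⟩
    have : x ∈ S ∩ (u ∩ v) := ⟨h1, h2, h3⟩
    rw [huv] at this
    exact this
  · rw [← inter_union_distrib_left]
    exact inter_eq_left.2 hsub

theorem two_pieces {L : Set ℂ} (hL : IsClosed L) (e : ℝ ≃ₜ L) :
    ∃ U V : Set ℂ, IsOpen U ∧ IsOpen V ∧ U.Nonempty ∧ V.Nonempty ∧ Disjoint U V ∧ U ∪ V = Lᶜ ∧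
      IsPreconnected U ∧ IsPreconnected V := by
  have hLn : L.Nonempty := ⟨_, (e 0).2⟩
  obtain ⟨Φ, Ψ, hΦ, hΨ, hΨΦ, hΦΨ, hzero⟩ := line_straighten hL e
  set δ : ℂ → ℝ := fun x => Metric.infDist x L with hδdef
  have hδ : Continuous δ := Metric.continuous_infDist_pt L
  have h0 : ∀ x, 0 ≤ δ x := fun x => Metric.infDist_nonneg
  have hpos : ∀ x, 0 < δ x ↔ x ∉ L := fun x => (hL.notMem_iff_infDist_pos hLn).symm
  have hposS : {x | 0 < δ x} = Lᶜ := by ext x; exact hpos x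
  have hW : ∀ p, p ∈ upS δ ∪ dnS δ ↔ (Φ p).1 ≠ 0 := by
    intro p
    rw [Ne, hzero]
    constructor
    · rintro h ⟨h1, h2⟩
      have h3 : δ p.1 = 0 := le_antisymm (not_lt.1 fun h => (hpos _).1 h h1) (h0 _)
      rcases h with h | h
      · have h : -δ p.1 < p.2 := h
        linarith
      · have h : p.2 < δ p.1 := h
        linarith
    · intro h
      by_contra hn
      simp only [mem_union, not_or] at hn
      have h1 : ¬ (-δ p.1 < p.2) := hn.1
      have h2 : ¬ (p.2 < δ p.1) := hn.2
      have h3 := h0 p.1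
      refine h ⟨?_, by linarith⟩
      by_contra h4
      have := (hpos _).2 h4
      linarith
  have hΨm : MapsTo Ψ {p | p.1 ≠ 0} (upS δ ∪ dnS δ) := fun p hp => by
    rw [hW, hΦΨ]; exact hp
  have hΦm : MapsTo Φ (upS δ ∪ dnS δ) {p | p.1 ≠ 0} := fun p hp => (hW p).1 hp
  -- the complement is not preconnected
  have hnot : ¬ IsPreconnected Lᶜ := by
    intro hc
    rw [← hposS] at hc
    obtain ⟨u, hu, hue⟩ := log_of_preconn hδ hc (f := fun p => (Φ p).1)
      (continuous_fst.comp hΦ).continuousOn (fun p hp => (hW p).1 hp)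
    refine model_no_log ⟨fun p => u (Ψ p), hu.comp hΨ.continuousOn hΨm, fun p hp => ?_⟩
    rw [hue _ (hΨm hp), hΦΨ]
  -- three pieces are impossible
  have hrep : ∀ V, Piece δ V → ∃ (n : ℤ) (w : ℂ × ℝ → ℂ), ContinuousOn w (upS δ ∪ dnS δ) ∧
      ∀ p ∈ upS δ ∪ dnS δ, fV δ V p = (Φ p).1 ^ n * Complex.exp (w p) := by
    intro V hV
    obtain ⟨n, u, hu, hue⟩ := model_repr (f := fun p => fV δ V (Ψ p))
      ((fV_cont hδ h0 hV).comp hΨ.continuousOn hΨm) (fun p hp => Complex.exp_ne_zero _)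
    refine ⟨n, fun p => u (Φ p), hu.comp hΦ.continuousOn hΦm, fun p hp => ?_⟩
    have := hue (Φ p) (hΦm hp)
    rwa [hΨΦ] at this
  have hthree : ∀ A B C : Set ℂ, IsOpen A → IsOpen B → IsOpen C → A.Nonempty → B.Nonempty →
      C.Nonempty → Disjoint A B → Disjoint A C → Disjoint B C → A ∪ B ∪ C = Lᶜ → False := by
    intro A B C hA hB hC ⟨a, ha⟩ ⟨b, hb⟩ ⟨c, hc⟩ hAB hAC hBC hU
    have hsub : ∀ x, (x ∈ A ∨ x ∈ B) ∨ x ∈ C → 0 < δ x := fun x hx => by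
      rw [hpos]
      have : x ∈ Lᶜ := by rw [← hU]; exact hx
      exact this
    have hcov : ∀ x, 0 < δ x → (x ∈ A ∨ x ∈ B) ∨ x ∈ C := fun x hx => by
      have : x ∈ A ∪ B ∪ C := by rw [hU]; exact (hpos x).1 hx
      exact this
    rw [disjoint_left] at hAB hAC hBC
    have hpA : Piece δ A := ⟨hA, fun x hx => hsub x (Or.inl (Or.inl hx)), by
      convert hB.union hC using 1
      ext x
      constructor
      · rintro ⟨h1, h2⟩
        rcases hcov x h1 with (h | h) | h
        · exact absurd h h2
        · exact Or.inl h
        · exact Or.inr h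
      · rintro (h | h)
        · exact ⟨hsub x (Or.inl (Or.inr h)), fun h' => hAB h' h⟩
        · exact ⟨hsub x (Or.inr h), fun h' => hAC h' h⟩⟩
    have hpB : Piece δ B := ⟨hB, fun x hx => hsub x (Or.inl (Or.inr hx)), by
      convert hA.union hC using 1
      ext x
      constructor
      · rintro ⟨h1, h2⟩
        rcases hcov x h1 with (h | h) | h
        · exact Or.inl h
        · exact absurd h h2
        · exact Or.inr h
      · rintro (h | h)
        · exact ⟨hsub x (Or.inl (Or.inl h)), fun h' => hAB h h'⟩
        · exact ⟨hsub x (Or.inr h), fun h' => hBC h' h⟩⟩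
    obtain ⟨n, w, hw, hwe⟩ := hrep A hpA
    obtain ⟨m, v, hv, hve⟩ := hrep B hpB
    have iAa : ind A a = 1 := by simp [ind, ha]
    have iAb : ind A b = 0 := if_neg fun h => hAB h hb
    have iAc : ind A c = 0 := if_neg fun h => hAC h hc
    have iBa : ind B a = 0 := by simp [ind, hAB ha]
    have iBb : ind B b = 1 := by simp [ind, hb]
    have iBc : ind B c = 0 := if_neg fun h => hBC h hc
    have hda := hsub a (Or.inl (Or.inl ha))
    have hdb := hsub b (Or.inl (Or.inr hb))
    have hdc := hsub c (Or.inr hc)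
    obtain ⟨k, hk⟩ := const_of_log hδ h0 hpA hpB m (-n) (u := fun p => m * w p + (-n : ℤ) * v p)
      ((hw.const_mul _).add (hv.const_mul _)) (fun p hp => by
        have h1 : (Φ p).1 ≠ 0 := (hW p).1 hp
        rw [hwe p hp, hve p hp, Complex.exp_add, Complex.exp_int_mul, Complex.exp_int_mul,
          mul_zpow, mul_zpow, ← zpow_mul, ← zpow_mul]
        have h2 : (Φ p).1 ^ (n * m) * (Φ p).1 ^ (m * -n) = 1 := by
          rw [← zpow_add₀ h1, show n * m + m * -n = 0 by ring, zpow_zero]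
        linear_combination (-Complex.exp (w p) ^ m * Complex.exp (v p) ^ (-n)) * h2)
    have k1 := hk a hda
    have k2 := hk b hdb
    have k3 := hk c hdc
    rw [iAa, iBa] at k1
    rw [iAb, iBb] at k2
    rw [iAc, iBc] at k3
    have hn : n = 0 := by linarith
    subst hn
    obtain ⟨j, hj⟩ := const_of_log hδ h0 hpA hpB 1 0 hw (fun p hp => by
      rw [hwe p hp]; simp)
    have j1 := hj a hda
    have j2 := hj b hdb
    rw [iAa, iBa] at j1
    rw [iAb, iBb] at j2
    omega
  obtain ⟨U, V, hU, hV, hUn, hVn, hUV, hUVL⟩ := split_of_not_preconn hL.isOpen_compl hnot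
  refine ⟨U, V, hU, hV, hUn, hVn, hUV, hUVL, ?_, ?_⟩
  · by_contra hc
    obtain ⟨A, B, hA, hB, hAn, hBn, hAB, rfl⟩ := split_of_not_preconn hU hc
    rw [disjoint_union_left] at hUV
    exact hthree A B V hA hB hV hAn hBn hVn hAB hUV.1 hUV.2 hUVL
  · by_contra hc
    obtain ⟨A, B, hA, hB, hAn, hBn, hAB, rfl⟩ := split_of_not_preconn hV hc
    rw [disjoint_union_right] at hUV
    exact hthree U A B hU hA hB hUn hAn hBn hUV.1 hUV.2 hAB (by rw [union_assoc]; exact hUVL)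

lemma piece_homeo {L U V : Set ℂ} (hL : IsClosed L) (e : ℝ ≃ₜ L) (hU : IsOpen U) (hV : IsOpen V)
    (hUn : U.Nonempty) (hVn : V.Nonempty) (hd : Disjoint U V) (hUV : U ∪ V = Lᶜ)
    (hUc : IsPreconnected U) (hVc : IsPreconnected V) : Nonempty (U ≃ₜ ℂ) := by
  have hLc : IsPreconnected L := by
    have : L = range (fun s => (e s : ℂ)) := by
      ext x
      exact ⟨fun hx => ⟨e.symm ⟨x, hx⟩, by simp⟩, by rintro ⟨s, rfl⟩; exact (e s).2⟩
    rw [this]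
    exact isPreconnected_range (continuous_subtype_val.comp e.continuous)
  rw [disjoint_left] at hd
  have hUL : ∀ x ∈ U, x ∉ L := fun x hx => by
    have : x ∈ Lᶜ := by rw [← hUV]; exact Or.inl hx
    exact this
  have hVL : ∀ x ∈ V, x ∉ L := fun x hx => by
    have : x ∈ Lᶜ := by rw [← hUV]; exact Or.inr hx
    exact this
  have hcompl : Uᶜ = L ∪ V := by
    ext x
    constructor
    · intro hx
      by_cases hxL : x ∈ L
      · exact Or.inl hxL
      · have : x ∈ U ∪ V := by rw [hUV]; exact hxL
        exact this.imp (fun h => absurd h hx) id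
    · rintro (h | h) hxU
      · exact hUL x hxU h
      · exact hd hxU h
  -- a frontier point of V in L
  have hfr : ∃ p ∈ L, p ∈ closure V := by
    by_contra! hno
    have hVcl : IsClosed V := by
      rw [← closure_eq_iff_isClosed]
      refine subset_antisymm (fun x hx => ?_) subset_closure
      have hxL : x ∉ L := fun h => hno x h hx
      have : x ∈ U ∪ V := by rw [hUV]; exact hxL
      rcases this with h | h
      · exfalso
        obtain ⟨y, hy1, hy2⟩ := mem_closure_iff.1 hx U hU h
        exact hd hy1 hy2
      · exact h
    have h1 : V = univ := IsClopen.eq_univ ⟨hVcl, hV⟩ hVn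
    obtain ⟨x, hx⟩ := hUn
    exact hd hx (by rw [h1]; trivial)
  obtain ⟨p, hpL, hpV⟩ := hfr
  have hpre : IsPreconnected Uᶜ := by
    have h1 : IsPreconnected (insert p V) :=
      hVc.subset_closure (subset_insert _ _) (insert_subset hpV subset_closure)
    have h2 : Uᶜ = L ∪ insert p V := by
      rw [hcompl, union_insert, insert_eq_of_mem (mem_union_left V hpL)]
    rw [h2]
    exact hLc.union p hpL (mem_insert _ _) h1
  refine homeo_complex hU hUc hUn hpre ?_
  by_contra! hb
  obtain ⟨R, hR⟩ := hb
  have hLb : Bornology.IsBounded L := by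
    refine (Metric.isBounded_closedBall (x := (0 : ℂ)) (r := R)).subset fun x hx => ?_
    have := hR x (by rw [hcompl]; exact Or.inl hx)
    simpa using this
  have hLk : IsCompact L := Metric.isCompact_of_isClosed_isBounded hL hLb
  have := isCompact_iff_compactSpace.1 hLk
  have : CompactSpace ℝ := e.symm.compactSpace
  exact not_compactSpace_iff.2 inferInstance this

theorem complex_main {L : Set ℂ} (hL : IsClosed L) (e : ℝ ≃ₜ L) :
    ∃ U V : Set ℂ, IsOpen U ∧ IsOpen V ∧ U.Nonempty ∧ V.Nonempty ∧ Disjoint U V ∧ U ∪ V = Lᶜ ∧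
      IsPreconnected U ∧ IsPreconnected V ∧ Nonempty (U ≃ₜ ℂ) ∧ Nonempty (V ≃ₜ ℂ) := by
  obtain ⟨U, V, hU, hV, hUn, hVn, hUV, hUVL, hUc, hVc⟩ := two_pieces hL e
  exact ⟨U, V, hU, hV, hUn, hVn, hUV, hUVL, hUc, hVc,
    piece_homeo hL e hU hV hUn hVn hUV hUVL hUc hVc,
    piece_homeo hL e hV hU hVn hUn hUV.symm (by rw [union_comm]; exact hUVL) hVc hUc⟩

lemma component_eq {X : Type*} [TopologicalSpace X] {U V S : Set X} (hU : IsOpen U) (hV : IsOpen V)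
    (hd : Disjoint U V) (hS : U ∪ V = S) (hUc : IsPreconnected U) {x : X} (hx : x ∈ U) :
    connectedComponentIn S x = U := by
  have hUS : U ⊆ S := by rw [← hS]; exact subset_union_left
  apply subset_antisymm
  · exact isPreconnected_connectedComponentIn.subset_left_of_subset_union hU hV hd
      (by rw [hS]; exact connectedComponentIn_subset S x)
      ⟨x, mem_connectedComponentIn (hUS hx), hx⟩
  · exact hUc.subset_connectedComponentIn hx hUS
end

open OnePoint
/-- If a closed subset L of ℝ² is homeomorphic to ℝ and L ∪ {∞} is a circle in the
one-point compactification S² of ℝ², then ℝ² \ L has exactly two connected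
components, each homeomorphic to ℝ². -/
theorem complement_of_closed_line_two_components
    (L : Set (EuclideanSpace ℝ (Fin 2))) (hL : IsClosed L)
    (hline : Nonempty (ℝ ≃ₜ L))
    (hclos : closure ((OnePoint.some : EuclideanSpace ℝ (Fin 2) → OnePoint (EuclideanSpace ℝ (Fin 2))) '' L) =
      (OnePoint.some : EuclideanSpace ℝ (Fin 2) → OnePoint (EuclideanSpace ℝ (Fin 2))) '' L ∪ {OnePoint.infty})
    (hcirc : Nonempty
      ((closure ((OnePoint.some : EuclideanSpace ℝ (Fin 2) → OnePoint (EuclideanSpace ℝ (Fin 2))) '' L) : Set (OnePoint (EuclideanSpace ℝ (Fin 2)))) ≃ₜ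
        Metric.sphere (0 : EuclideanSpace ℝ (Fin 2)) 1)) :
    ∃ U V : Set (EuclideanSpace ℝ (Fin 2)), U ≠ V ∧
      (∀ x ∈ Lᶜ, connectedComponentIn Lᶜ x = U ∨ connectedComponentIn Lᶜ x = V) ∧
      (∃ x ∈ Lᶜ, connectedComponentIn Lᶜ x = U) ∧
      (∃ x ∈ Lᶜ, connectedComponentIn Lᶜ x = V) ∧
      Nonempty (U ≃ₜ EuclideanSpace ℝ (Fin 2)) ∧
      Nonempty (V ≃ₜ EuclideanSpace ℝ (Fin 2)) := by
  classical
  obtain ⟨e⟩ := hline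
  let φ : EuclideanSpace ℝ (Fin 2) ≃ₜ ℂ :=
    Complex.orthonormalBasisOneI.repr.symm.toHomeomorph
  obtain ⟨U, V, hU, hV, ⟨a, ha⟩, ⟨b, hb⟩, hd, hUV, hUc, hVc, ⟨f⟩, ⟨g⟩⟩ :=
    complex_main (L := φ '' L) (φ.isClosedMap _ hL) (e.trans (φ.image L))
  have hS : φ ⁻¹' U ∪ φ ⁻¹' V = Lᶜ := by
    rw [← Set.preimage_union, hUV, Set.preimage_compl, Set.preimage_image_eq _ φ.injective]
  have hU' : IsOpen (φ ⁻¹' U) := hU.preimage φ.continuous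
  have hV' : IsOpen (φ ⁻¹' V) := hV.preimage φ.continuous
  have hd' : Disjoint (φ ⁻¹' U) (φ ⁻¹' V) := hd.preimage φ
  have hUc' : IsPreconnected (φ ⁻¹' U) := (φ.isPreconnected_preimage).2 hUc
  have hVc' : IsPreconnected (φ ⁻¹' V) := (φ.isPreconnected_preimage).2 hVc
  have ha' : φ.symm a ∈ φ ⁻¹' U := by simpa using ha
  have hb' : φ.symm b ∈ φ ⁻¹' V := by simpa using hb
  have hcU : ∀ x ∈ φ ⁻¹' U, connectedComponentIn Lᶜ x = φ ⁻¹' U := fun x hx =>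
    component_eq hU' hV' hd' hS hUc' hx
  have hcV : ∀ x ∈ φ ⁻¹' V, connectedComponentIn Lᶜ x = φ ⁻¹' V := fun x hx =>
    component_eq hV' hU' hd'.symm (by rw [Set.union_comm]; exact hS) hVc' hx
  have hpre : ∀ W : Set ℂ, Nonempty (W ≃ₜ ℂ) →
      Nonempty ((φ ⁻¹' W : Set (EuclideanSpace ℝ (Fin 2))) ≃ₜ EuclideanSpace ℝ (Fin 2)) := by
    rintro W ⟨k⟩
    exact ⟨((φ.sets (by rfl)).trans k).trans φ.symm⟩
  refine ⟨φ ⁻¹' U, φ ⁻¹' V, ?_, ?_, ⟨φ.symm a, ?_, hcU _ ha'⟩, ⟨φ.symm b, ?_, hcV _ hb'⟩,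
    hpre U ⟨f⟩, hpre V ⟨g⟩⟩
  · intro h
    rw [h] at ha' hd'
    exact Set.disjoint_left.1 hd' ha' ha'
  · intro x hx
    rw [← hS] at hx
    exact hx.imp (hcU x) (hcV x)
  · rw [← hS]; exact Or.inl ha'
  · rw [← hS]; exact Or.inr hb'
end
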